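/- arXiv:2105.05025 — 2 statements merged into one kernel-verified Lean document; each statement's English description precedes it below -/
import Mathlib

section
/- Let n ≥ 2, let f ∈ L²(S¹;ℝⁿ), and let u : S¹ → ℝⁿ be measurable with u(x) ∈ S^{n−1} for a.e. x and ‖u‖_{Ḣ^{1/2}} < ∞, which solves weakly the equation (−Δ)^{1/2}u = u|d_{1/2}u|² + f, i.e. for every φ ∈ C^∞(S¹;ℝⁿ): ∫_{S¹}∫_{S¹} d_{1/2}u(x,y)·d_{1/2}φ(x,y) (dy dx/|x−y|) = ∫_{S¹} (|d_{1/2}u|²(x)·u(x) + f(x))·φ(x) dx. Then u has the improved regularity u ∈ H¹(S¹), i.e. Σ_{k∈ℤ}(1+k²)|û(k)|² < ∞. -/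
open MeasureTheory Real Filter
open scoped BigOperators ENNReal Real Topology

noncomputable section

/-- Chord distance on `S¹ ≃ ℝ/2πℤ`: `|x-y| = 2|sin((x-y)/2)|`. -/
def cd (x y : ℝ) : ℝ := 2 * |Real.sin ((x - y) / 2)|

/-- Fundamental domain for the circle `S¹ ≃ ℝ/2πℤ`. -/
def circ : Set ℝ := Set.Ioc (-π) π

/-- `k`-th Fourier coefficient of a `2π`-periodic function `ℝ → ℂ`. -/
def fc (f : ℝ → ℂ) (k : ℤ) : ℂ :=
  ((1 / (2 * π) : ℝ) : ℂ) * ∫ x in circ, f x * Complex.exp (-(Complex.I * (k : ℂ) * (x : ℂ)))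

/-- Fourier coefficient of a real-valued function. -/
def fcR (f : ℝ → ℝ) (k : ℤ) : ℂ := fc (fun x => (f x : ℂ)) k

/-- `ℝⁿ` as a Euclidean space. -/
abbrev E (n : ℕ) := EuclideanSpace ℝ (Fin n)

/-- Componentwise Fourier coefficients of a vector-valued map. -/
def fcV {n : ℕ} (u : ℝ → E n) (k : ℤ) (i : Fin n) : ℂ := fcR (fun x => u x i) k

/-- Squared homogeneous `Ḣ^{1/2}` seminorm: `∑_k |k| |û(k)|²` (valued in `[0,∞]`). -/
def hHalf {n : ℕ} (u : ℝ → E n) : ℝ≥0∞ :=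
  ∑' k : ℤ, (k.natAbs : ℝ≥0∞) * ∑ i, (‖fcV u k i‖₊ : ℝ≥0∞) ^ 2

/-- Squared inhomogeneous `H^s` norm: `∑_k (1+k²)^s |û(k)|²` (valued in `[0,∞]`). -/
def hSob {n : ℕ} (s : ℝ) (u : ℝ → E n) : ℝ≥0∞ :=
  ∑' k : ℤ, ENNReal.ofReal ((1 + (k : ℝ) ^ 2) ^ s) * ∑ i, (‖fcV u k i‖₊ : ℝ≥0∞) ^ 2

/-- Squared homogeneous `Ḣ^{1/2}` seminorm of a scalar function. -/
def hHalfR (f : ℝ → ℝ) : ℝ≥0∞ :=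
  ∑' k : ℤ, (k.natAbs : ℝ≥0∞) * (‖fcR f k‖₊ : ℝ≥0∞) ^ 2

/-- Squared inhomogeneous `H^s` norm of a scalar function. -/
def hSobR (s : ℝ) (f : ℝ → ℝ) : ℝ≥0∞ :=
  ∑' k : ℤ, ENNReal.ofReal ((1 + (k : ℝ) ^ 2) ^ s) * (‖fcR f k‖₊ : ℝ≥0∞) ^ 2

/-- `|d_{1/2}u|²(x) = ∫_{S¹} |u(x)-u(y)|²/|x-y|² dy`. -/
def gagl {n : ℕ} (u : ℝ → E n) (x : ℝ) : ℝ :=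
  ∫ y in circ, (∑ i, (u x i - u y i) ^ 2) / cd x y ^ 2

/-- `∫_{S¹}∫_{S¹} d_{1/2}u(x,y)·d_{1/2}φ(x,y) dy dx/|x-y|`. -/
def pairing {n : ℕ} (u φ : ℝ → E n) : ℝ :=
  ∫ x in circ, ∫ y in circ, (∑ i, (u x i - u y i) * (φ x i - φ y i)) / cd x y ^ 2

/-- The product measure on `(0,∞) × S¹`. -/
def STmeasure : Measure (ℝ × ℝ) :=
  (volume.restrict (Set.Ioi (0 : ℝ))).prod (volume.restrict circ)

/-- Smooth test functions on `(0,∞) × S¹`, compactly supported in time. -/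
structure IsSTTest (n : ℕ) (φ : ℝ → ℝ → E n) : Prop where
  smooth : ContDiff ℝ (⊤ : ℕ∞) (fun p : ℝ × ℝ => φ p.1 p.2)
  periodic : ∀ t, Function.Periodic (φ t) (2 * π)
  suppTime : ∃ a b : ℝ, 0 < a ∧ ∀ t, t ∉ Set.Icc a b → ∀ x, φ t x = 0

/-- Energy-class solution of the half-harmonic gradient flow, with explicit
weak time derivative `w`. -/
structure IsEnergySolAux (n : ℕ) (u₀ : ℝ → E n) (u w : ℝ → ℝ → E n) : Prop where
  meas : Measurable (Function.uncurry u)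
  periodic : ∀ t, Function.Periodic (u t) (2 * π)
  sphere : ∀ᵐ p ∂STmeasure, ‖u p.1 p.2‖ = 1
  energyBdd : ∃ M : ℝ≥0∞, M < ⊤ ∧
    ∀ᵐ t ∂(volume.restrict (Set.Ioi (0 : ℝ))), hHalf (u t) ≤ M
  wMeas : Measurable (Function.uncurry w)
  wL2 : (∫⁻ t in Set.Ioi (0 : ℝ), ∫⁻ x in circ, (‖w t x‖₊ : ℝ≥0∞) ^ 2) < ⊤
  weakDeriv : ∀ φ : ℝ → ℝ → E n, IsSTTest n φ →
    (∫ t in Set.Ioi (0 : ℝ), ∫ x in circ, ∑ i, u t x i * deriv (fun s => φ s x i) t)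
      = - ∫ t in Set.Ioi (0 : ℝ), ∫ x in circ, ∑ i, w t x i * φ t x i
  flow : ∀ φ : ℝ → ℝ → E n, IsSTTest n φ →
    (∫ t in Set.Ioi (0 : ℝ), ∫ x in circ, ∑ i, w t x i * φ t x i)
      + (∫ t in Set.Ioi (0 : ℝ), pairing (u t) (φ t))
      = ∫ t in Set.Ioi (0 : ℝ), ∫ x in circ, gagl (u t) x * ∑ i, u t x i * φ t x i
  init : Tendsto (fun t => ∫⁻ x in circ, (‖u t x - u₀ x‖₊ : ℝ≥0∞) ^ 2)
      (nhdsWithin 0 (Set.Ioi 0)) (nhds 0)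

/-- Energy-class solution of the half-harmonic gradient flow. -/
def IsEnergySol (n : ℕ) (u₀ : ℝ → E n) (u : ℝ → ℝ → E n) : Prop :=
  ∃ w, IsEnergySolAux n u₀ u w

/-- Energy decay: `‖u(t,·)‖_{Ḣ^{1/2}} ≤ ‖u₀‖_{Ḣ^{1/2}}` for a.e. `t ≥ 0`. -/
def EnergyDecay {n : ℕ} (u₀ : ℝ → E n) (u : ℝ → ℝ → E n) : Prop :=
  ∀ᵐ t ∂(volume.restrict (Set.Ioi (0 : ℝ))), hHalf (u t) ≤ hHalf u₀

/-- Fractional Laplacian `(-Δ)^s` of a `2π`-periodic function, via Fourier series. -/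
def fracLapC (s : ℝ) (f : ℝ → ℂ) (x : ℝ) : ℂ :=
  ∑' k : ℤ, (((k.natAbs : ℝ) ^ s : ℝ) : ℂ) * fc f k * Complex.exp (Complex.I * (k : ℂ) * (x : ℂ))

/-- Fractional Laplacian of a real-valued function. -/
def fracLapR (s : ℝ) (f : ℝ → ℝ) (x : ℝ) : ℝ := (fracLapC s (fun y => (f y : ℂ)) x).re

/-- Half-Laplacian of a vector-valued map. -/
def halfLap {n : ℕ} (u : ℝ → E n) (x : ℝ) : E n :=
  (EuclideanSpace.equiv (Fin n) ℝ).symm fun i => fracLapR 1 (fun y => u y i) x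

/-- The integral `C(j,k) = ∫_{-π}^{π} (e^{ijh}-1)(e^{ikh}-1)/(4sin²(h/2)) dh`. -/
def Cjk (j k : ℤ) : ℂ :=
  ∫ h in circ, (Complex.exp (Complex.I * (j : ℂ) * (h : ℂ)) - 1)
      * (Complex.exp (Complex.I * (k : ℂ) * (h : ℂ)) - 1)
      / ((4 * Real.sin (h / 2) ^ 2 : ℝ) : ℂ)

/-- A real trigonometric polynomial: the function equals a finite Fourier sum. -/
def IsTrigPoly (u : ℝ → ℝ) : Prop :=
  ∃ s : Finset ℤ, ∀ x : ℝ,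
    (u x : ℂ) = ∑ k ∈ s, fcR u k * Complex.exp (Complex.I * (k : ℂ) * (x : ℂ))

/-- `d_{1/2}u · d_{1/2}v` as a (complex-valued) function on the circle. -/
def d12prod (u v : ℝ → ℝ) (x : ℝ) : ℂ :=
  ((∫ y in circ, (u x - u y) * (v x - v y) / cd x y ^ 2 : ℝ) : ℂ)

/-- Stereographic projection of `S¹ ∖ {-i}`. -/
def stproj (θ : ℝ) : ℝ := Real.cos θ / (1 + Real.sin θ)

/-- A concave truncation of `|t|`, bounded by `√(N |t|)`. -/
def truncAbs (N t : ℝ) : ℝ := √(|t| * min |t| N)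

lemma truncAbs_nonneg (N t : ℝ) : 0 ≤ truncAbs N t := Real.sqrt_nonneg _

lemma truncAbs_neg (N t : ℝ) : truncAbs N (-t) = truncAbs N t := by simp [truncAbs]

lemma truncAbs_sq {N : ℝ} (hN : 0 ≤ N) (t : ℝ) : truncAbs N t ^ 2 = |t| * min |t| N :=
  Real.sq_sqrt (mul_nonneg (abs_nonneg t) (le_min (abs_nonneg t) hN))

lemma truncAbs_mono {N : ℝ} (hN : 0 ≤ N) {a b : ℝ} (h : |a| ≤ |b|) :
    truncAbs N a ≤ truncAbs N b := by
  refine Real.sqrt_le_sqrt (mul_le_mul h (min_le_min_right _ h) (le_min (abs_nonneg a) hN)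
    (abs_nonneg b))

lemma truncAbs_le_abs {N : ℝ} (t : ℝ) : truncAbs N t ≤ |t| := by
  refine Real.sqrt_le_iff.2 ⟨abs_nonneg t, ?_⟩
  rw [sq]
  exact mul_le_mul_of_nonneg_left (min_le_left _ _) (abs_nonneg t)

lemma truncAbs_mul_abs_le {N : ℝ} (hN : 0 ≤ N) {a b : ℝ} (h : |a| ≤ |b|) :
    truncAbs N b * |a| ≤ truncAbs N a * |b| := by
  refine abs_le_of_sq_le_sq' ?_ (mul_nonneg (truncAbs_nonneg _ _) (abs_nonneg b)) |>.2
  rw [mul_pow, mul_pow, truncAbs_sq hN, truncAbs_sq hN]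
  have ha := abs_nonneg a
  have hb := abs_nonneg b
  have key : min |b| N * |a| ≤ min |a| N * |b| := by
    rcases le_total |a| N with h1 | h1
    · rw [min_eq_left h1, mul_comm]
      exact mul_le_mul_of_nonneg_left (min_le_left _ _) ha
    · rw [min_eq_right h1, min_eq_right (h1.trans h)]
      exact mul_le_mul_of_nonneg_left h hN
  calc |b| * min |b| N * |a| ^ 2 = |a| * |b| * (min |b| N * |a|) := by ring
    _ ≤ |a| * |b| * (min |a| N * |b|) := mul_le_mul_of_nonneg_left key (mul_nonneg ha hb)
    _ = _ := by ring

lemma truncAbs_div_le {N : ℝ} (hN : 0 ≤ N) {a b : ℝ} (h : |a| ≤ |b|) :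
    truncAbs N b / |b| * |a| ≤ truncAbs N a := by
  rcases eq_or_lt_of_le (abs_nonneg b) with hb | hb
  · rw [← hb, div_zero, zero_mul]
    exact truncAbs_nonneg _ _
  · rw [div_mul_eq_mul_div, div_le_iff₀ hb]
    exact truncAbs_mul_abs_le hN h

lemma truncAbs_div_mul_self (N t : ℝ) : truncAbs N t / |t| * |t| = truncAbs N t := by
  rcases eq_or_ne t 0 with rfl | h
  · simp [truncAbs]
  · field_simp

lemma truncAbs_add_le {N : ℝ} (hN : 0 ≤ N) (a b : ℝ) :
    truncAbs N (a + b) ≤ truncAbs N a + truncAbs N b := by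
  rcases le_total |a + b| |a| with h | h
  · linarith [truncAbs_mono hN h, truncAbs_nonneg N b]
  rcases le_total |a + b| |b| with h' | h'
  · linarith [truncAbs_mono hN h', truncAbs_nonneg N a]
  have h0 : 0 ≤ truncAbs N (a + b) / |a + b| := div_nonneg (truncAbs_nonneg _ _) (abs_nonneg _)
  calc truncAbs N (a + b) = truncAbs N (a + b) / |a + b| * |a + b| :=
        (truncAbs_div_mul_self _ _).symm
    _ ≤ truncAbs N (a + b) / |a + b| * (|a| + |b|) :=
        mul_le_mul_of_nonneg_left (abs_add_le a b) h0
    _ ≤ _ := by rw [mul_add]; exact add_le_add (truncAbs_div_le hN h) (truncAbs_div_le hN h')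

lemma abs_truncAbs_sub_le {N : ℝ} (hN : 0 ≤ N) (a b : ℝ) :
    |truncAbs N (a + b) - truncAbs N a| ≤ truncAbs N b := by
  have h1 := truncAbs_add_le hN a b
  have h2 := truncAbs_add_le hN (a + b) (-b)
  rw [truncAbs_neg, add_neg_cancel_right] at h2
  exact abs_sub_le_iff.2 ⟨by linarith, by linarith⟩

/-- Bound for the symbol of the commutator in the normal direction. -/
lemma abs_truncAbs_add_sub_le {N : ℝ} (hN : 0 ≤ N) (k m : ℝ) :
    |truncAbs N k + truncAbs N m - truncAbs N (k + m)| ≤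
      2 * min (truncAbs N k) (truncAbs N m) := by
  have h1 := abs_le.1 (abs_truncAbs_sub_le hN k m)
  have h2 := abs_le.1 (abs_truncAbs_sub_le hN m k)
  rw [add_comm m k] at h2
  have h3 := truncAbs_nonneg N k
  have h4 := truncAbs_nonneg N m
  rcases le_total (truncAbs N k) (truncAbs N m) with h | h
  · rw [min_eq_left h, abs_le]
    constructor <;> linarith
  · rw [min_eq_right h, abs_le]
    constructor <;> linarith

lemma abs_truncAbs_sub_sub_le_three_mul {N : ℝ} (hN : 0 ≤ N) (k m : ℝ) :
    |truncAbs N m - truncAbs N k - truncAbs N (k + m) / |k + m| * (|m| - |k|)| ≤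
      3 * truncAbs N k := by
  have hθ : 0 ≤ truncAbs N (k + m) / |k + m| := div_nonneg (truncAbs_nonneg _ _) (abs_nonneg _)
  have h0 := truncAbs_div_mul_self N (k + m)
  set θ := truncAbs N (k + m) / |k + m| with hθd
  have hk := truncAbs_nonneg N k
  rcases le_total |k + m| |k| with hn | hn
  · have h1 := abs_truncAbs_sub_le hN (-k) (k + m)
    rw [neg_add_cancel_left, truncAbs_neg] at h1
    have h2 : |(|m| - |k|)| ≤ |k + m| := by
      have := abs_abs_sub_abs_le_abs_sub m (-k)
      rwa [abs_neg, sub_neg_eq_add, add_comm m k] at this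
    have h3 : |θ * (|m| - |k|)| ≤ truncAbs N (k + m) := by
      rw [abs_mul, abs_of_nonneg hθ, ← h0]
      exact mul_le_mul_of_nonneg_left h2 hθ
    have h4 := truncAbs_mono hN hn
    have := abs_sub (truncAbs N m - truncAbs N k) (θ * (|m| - |k|))
    linarith
  · have h1 := abs_le.1 (abs_truncAbs_sub_le hN m k)
    rw [add_comm m k] at h1
    have h2 : |(|k + m| - |m|)| ≤ |k| := by
      have := abs_abs_sub_abs_le_abs_sub (k + m) m
      rwa [add_sub_cancel_right] at this
    have h3 : θ * |k| ≤ truncAbs N k := truncAbs_div_le hN hn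
    have h4 : |θ * (|k + m| - |m|)| ≤ truncAbs N k := by
      rw [abs_mul, abs_of_nonneg hθ]
      exact (mul_le_mul_of_nonneg_left h2 hθ).trans h3
    have h4 := abs_le.1 h4
    have h5 : 0 ≤ θ * |k| := mul_nonneg hθ (abs_nonneg k)
    rw [mul_sub, h0] at h4
    rw [mul_sub, abs_le]
    constructor <;> linarith

/-- Bound for the symbol of the commutator in the tangential directions. -/
lemma abs_truncAbs_sub_sub_le {N : ℝ} (hN : 0 ≤ N) (k m : ℝ) :
    |truncAbs N m - truncAbs N k - truncAbs N (k + m) / |k + m| * (|m| - |k|)| ≤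
      3 * min (truncAbs N k) (truncAbs N m) := by
  rcases le_total |k| |m| with h | h
  · rw [min_eq_left (truncAbs_mono hN h)]
    exact abs_truncAbs_sub_sub_le_three_mul hN _ _
  · rw [min_eq_right (truncAbs_mono hN h)]
    have := abs_truncAbs_sub_sub_le_three_mul hN m k
    rw [add_comm m k] at this
    rw [← abs_neg]
    refine le_of_eq_of_le (congrArg _ ?_) this
    ring

lemma ENNReal.tsum_mul_sq_le {ι : Type*} (f g : ι → ℝ≥0∞) :
    (∑' k, f k * g k) ^ 2 ≤ (∑' k, f k ^ 2) * ∑' k, g k ^ 2 := by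
  let _ : MeasurableSpace ι := ⊤
  have h := ENNReal.lintegral_mul_le_Lp_mul_Lq (Measure.count : Measure ι)
    (Real.HolderConjugate.two_two) (f := f) (g := g)
    (measurable_from_top).aemeasurable (measurable_from_top).aemeasurable
  simp only [lintegral_count, Pi.mul_apply, ENNReal.rpow_two] at h
  calc _ ≤ _ := pow_le_pow_left' h 2
    _ = _ := by
      rw [mul_pow, ← ENNReal.rpow_natCast, ← ENNReal.rpow_natCast, ← ENNReal.rpow_mul,
        ← ENNReal.rpow_mul]
      norm_num

lemma ENNReal.add_sq_le_four_mul (a b : ℝ≥0∞) : (a + b) ^ 2 ≤ 4 * (a ^ 2 + b ^ 2) := by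
  rcases le_total a b with h | h
  · calc (a + b) ^ 2 ≤ (b + b) ^ 2 := by gcongr
      _ = 4 * b ^ 2 := by ring
      _ ≤ _ := by gcongr; exact le_add_self
  · calc (a + b) ^ 2 ≤ (a + a) ^ 2 := by gcongr
      _ = 4 * a ^ 2 := by ring
      _ ≤ _ := by gcongr; exact le_self_add

lemma ENNReal.tsum_sub_left (f : ℤ → ℝ≥0∞) (n : ℤ) : ∑' k, f (n - k) = ∑' k, f k :=
  (Equiv.subLeft n).tsum_eq f

lemma ENNReal.tsum_sub_right (f : ℤ → ℝ≥0∞) (k : ℤ) : ∑' n, f (n - k) = ∑' n, f n :=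
  (Equiv.subRight k).tsum_eq f

/-- `truncAbs` at integers, with values in `[0, ∞]`. -/
def truncWeight (N : ℝ) (k : ℤ) : ℝ≥0∞ := ENNReal.ofReal (truncAbs N k)

lemma truncWeight_sq {N : ℕ} (k : ℤ) :
    truncWeight N k ^ 2 = (k.natAbs : ℝ≥0∞) * min (k.natAbs : ℝ≥0∞) N := by
  have h : |(k : ℝ)| = (k.natAbs : ℝ) := by rw [Nat.cast_natAbs, Int.cast_abs]
  rw [truncWeight, ← ENNReal.ofReal_pow (truncAbs_nonneg _ _), truncAbs_sq (Nat.cast_nonneg N), h,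
    ENNReal.ofReal_mul (Nat.cast_nonneg _), ENNReal.ofReal_min, ENNReal.ofReal_natCast,
    ENNReal.ofReal_natCast]

lemma truncWeight_le (N : ℝ) (k : ℤ) : truncWeight N k ≤ k.natAbs := by
  refine (ENNReal.ofReal_le_ofReal (truncAbs_le_abs (k : ℝ))).trans_eq ?_
  rw [← Int.cast_abs, Int.abs_eq_natAbs, Int.cast_natCast, ENNReal.ofReal_natCast]

lemma truncWeight_le_mul_div {N : ℕ} {k m : ℤ} (h : |k| ≤ |m|) :
    truncWeight N k ≤ (k.natAbs : ℝ≥0∞) ^ (1 / 2 : ℝ) *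
      (truncWeight N m * ((m.natAbs : ℝ≥0∞) ^ (1 / 2 : ℝ))⁻¹) := by
  have hkm : k.natAbs ≤ m.natAbs := Int.natAbs_le_iff_sq_le.2 (sq_le_sq.2 h)
  rcases eq_or_ne m 0 with rfl | hm
  · have : k = 0 := by simpa using h
    simp [this, truncWeight, truncAbs]
  have hm' : (m.natAbs : ℝ≥0∞) ^ (1 / 2 : ℝ) ≠ 0 := by
    simpa using hm
  have hm'' : (m.natAbs : ℝ≥0∞) ^ (1 / 2 : ℝ) ≠ ⊤ :=
    ENNReal.rpow_ne_top_of_nonneg (by norm_num) (ENNReal.natCast_ne_top _)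
  rw [← mul_assoc, ← div_eq_mul_inv, ENNReal.le_div_iff_mul_le (Or.inl hm') (Or.inl hm'')]
  have hroot (j : ℕ) : ((j : ℝ≥0∞) ^ (1 / 2 : ℝ)) ^ 2 = j := by
    rw [← ENNReal.rpow_natCast, ← ENNReal.rpow_mul]
    norm_num
  refine (ENNReal.pow_le_pow_left_iff (two_ne_zero)).1 ?_
  rw [mul_pow, mul_pow, hroot, hroot, truncWeight_sq, truncWeight_sq]
  calc (k.natAbs : ℝ≥0∞) * min (k.natAbs : ℝ≥0∞) N * m.natAbs
      ≤ k.natAbs * min (m.natAbs : ℝ≥0∞) N * m.natAbs := by gcongr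
    _ = _ := by ring

lemma tsum_indicator_abs_le {m : ℤ} (hm : m ≠ 0) :
    ∑' k : ℤ, (if |k| ≤ |m| then (1 : ℝ≥0∞) else 0) ≤ 3 * m.natAbs := by
  have h : ∀ k : ℤ, |k| ≤ |m| ↔ k ∈ Finset.Icc (-|m|) |m| := fun k => by
    rw [Finset.mem_Icc, abs_le]
  simp only [h]
  rw [tsum_eq_sum (s := Finset.Icc (-|m|) |m|) (fun k hk => if_neg hk), Finset.sum_ite_mem,
    Finset.inter_self, Finset.sum_const, Int.card_Icc, nsmul_eq_mul, mul_one]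
  have h1 := Int.abs_eq_natAbs m
  have h2 : (|m| + 1 - -|m|).toNat ≤ 3 * m.natAbs := by omega
  exact_mod_cast h2

/-- The quadratic convolution controlling the commutators. -/
def commConv (N : ℝ) (x : ℤ → ℝ≥0∞) (n : ℤ) : ℝ≥0∞ :=
  ∑' k, x k * x (n - k) * min (truncWeight N k) (truncWeight N (n - k))

lemma commConv_le {N : ℕ} (x : ℤ → ℝ≥0∞) (n : ℤ) :
    commConv N x n ≤
      2 * ∑' k, if |k| ≤ |n - k| then x k * truncWeight N k * x (n - k) else 0 := by
  set F : ℤ → ℝ≥0∞ := fun k => if |k| ≤ |n - k| then x k * truncWeight N k * x (n - k) else 0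
    with hF
  rw [two_mul]
  nth_rewrite 2 [← ENNReal.tsum_sub_left F n]
  rw [← ENNReal.tsum_add]
  refine ENNReal.tsum_le_tsum fun k => ?_
  simp only [hF, sub_sub_cancel]
  rcases le_total |k| |n - k| with h | h
  · rw [if_pos h]
    refine le_trans ?_ le_self_add
    calc _ ≤ x k * x (n - k) * truncWeight N k := by gcongr; exact min_le_left _ _
      _ = _ := by ring
  · rw [if_pos h]
    refine le_trans ?_ le_add_self
    calc _ ≤ x k * x (n - k) * truncWeight N (n - k) := by gcongr; exact min_le_right _ _
      _ = _ := by ring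

lemma tsum_commConv_sq_le {N : ℕ} (x : ℤ → ℝ≥0∞) (s : Finset ℤ) :
    ∑' n, commConv N x n ^ 2 ≤
      16 * ((∑ k ∈ s, (x k * k.natAbs) ^ 2) * (s.card * ∑' k, x k ^ 2) +
        (∑' k : {k // k ∉ s}, (k : ℤ).natAbs * x k ^ 2) *
          (3 * ∑' k, truncWeight N k ^ 2 * x k ^ 2)) := by
  classical
  set χ : ℤ → ℝ≥0∞ := fun k => if k ∈ s then 1 else 0 with hχ
  set y : ℤ → ℝ≥0∞ := fun k => if k ∈ s then x k * k.natAbs else 0 with hy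
  set a : ℤ → ℝ≥0∞ := fun k => if k ∈ s then 0 else (k.natAbs : ℝ≥0∞) ^ (1 / 2 : ℝ) * x k with ha
  set b : ℤ → ℝ≥0∞ := fun m => truncWeight N m * ((m.natAbs : ℝ≥0∞) ^ (1 / 2 : ℝ))⁻¹ * x m with hb
  set M : ℤ → ℤ → ℝ≥0∞ := fun n k => if |k| ≤ |n - k| then b (n - k) else 0 with hM
  have hroot (j : ℕ) : ((j : ℝ≥0∞) ^ (1 / 2 : ℝ)) ^ 2 = j := by
    rw [← ENNReal.rpow_natCast, ← ENNReal.rpow_mul]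
    norm_num
  have hpt (n : ℤ) : commConv N x n ^ 2 ≤
      16 * ((∑' k, y k ^ 2) * (∑' k, (χ k * x (n - k)) ^ 2) +
        (∑' k, a k ^ 2) * ∑' k, M n k ^ 2) := by
    have h1 : (∑' k, if |k| ≤ |n - k| then x k * truncWeight N k * x (n - k) else 0) ≤
        (∑' k, y k * (χ k * x (n - k))) + ∑' k, a k * M n k := by
      rw [← ENNReal.tsum_add]
      refine ENNReal.tsum_le_tsum fun k => ?_
      split_ifs with h
      · by_cases hk : k ∈ s
        · simp only [hy, hχ, ha, if_pos hk, one_mul, zero_mul, add_zero]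
          gcongr
          exact truncWeight_le _ _
        · simp only [hy, hχ, ha, hM, if_neg hk, if_pos h, zero_mul, zero_add, hb]
          calc _ ≤ _ := mul_le_mul_left (mul_le_mul_right (truncWeight_le_mul_div h) (x k)) _
            _ = _ := by ring
      · exact zero_le
    calc commConv N x n ^ 2 ≤ (2 * ((∑' k, y k * (χ k * x (n - k))) + ∑' k, a k * M n k)) ^ 2 :=
          pow_le_pow_left' ((commConv_le x n).trans (mul_le_mul_right h1 2)) 2
      _ = 4 * ((∑' k, y k * (χ k * x (n - k))) + ∑' k, a k * M n k) ^ 2 := by ring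
      _ ≤ 4 * (4 * ((∑' k, y k * (χ k * x (n - k))) ^ 2 + (∑' k, a k * M n k) ^ 2)) := by
          gcongr; exact ENNReal.add_sq_le_four_mul _ _
      _ = 16 * ((∑' k, y k * (χ k * x (n - k))) ^ 2 + (∑' k, a k * M n k) ^ 2) := by ring
      _ ≤ _ := by gcongr <;> exact ENNReal.tsum_mul_sq_le _ _
  have hysum : ∑' k, y k ^ 2 = ∑ k ∈ s, (x k * k.natAbs) ^ 2 := by
    rw [tsum_eq_sum (s := s) (fun k hk => by simp [hy, hk])]
    exact Finset.sum_congr rfl fun k hk => by simp [hy, hk]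
  have hχsum : ∑' n, ∑' k, (χ k * x (n - k)) ^ 2 = s.card * ∑' k, x k ^ 2 := by
    rw [ENNReal.tsum_comm]
    simp_rw [mul_pow, ENNReal.tsum_mul_left, ENNReal.tsum_sub_right (fun j => x j ^ 2)]
    rw [ENNReal.tsum_mul_right, tsum_eq_sum (s := s) (fun k hk => by simp [hχ, hk])]
    congr 1
    rw [Finset.sum_congr rfl (g := fun _ => (1 : ℝ≥0∞)) (fun k hk => by simp [hχ, hk])]
    simp
  have hasum : ∑' k, a k ^ 2 = ∑' k : {k // k ∉ s}, ((k : ℤ).natAbs : ℝ≥0∞) * x k ^ 2 := by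
    refine Eq.trans ?_ (tsum_subtype {k | k ∉ s}
      (fun k : ℤ => (k.natAbs : ℝ≥0∞) * x k ^ 2)).symm
    refine tsum_congr fun k => ?_
    by_cases hk : k ∈ s
    · simp [ha, hk]
    · simp only [ha, if_neg hk, mul_pow, hroot]
      rw [Set.indicator_of_mem (by exact hk)]
  have hMsum : ∑' n, ∑' k, M n k ^ 2 ≤ 3 * ∑' k, truncWeight N k ^ 2 * x k ^ 2 := by
    rw [ENNReal.tsum_comm]
    calc ∑' k, ∑' n, M n k ^ 2
        = ∑' k : ℤ, ∑' m : ℤ, (if |k| ≤ |m| then b m else 0) ^ 2 :=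
          tsum_congr fun k => ENNReal.tsum_sub_right (fun m => (if |k| ≤ |m| then b m else 0) ^ 2) k
      _ = ∑' m : ℤ, ∑' k : ℤ, b m ^ 2 * (if |k| ≤ |m| then 1 else 0) := by
          rw [ENNReal.tsum_comm]
          refine tsum_congr fun m => tsum_congr fun k => ?_
          split_ifs <;> simp
      _ = ∑' m : ℤ, b m ^ 2 * ∑' k : ℤ, (if |k| ≤ |m| then 1 else 0) := by
          simp_rw [ENNReal.tsum_mul_left]
      _ ≤ ∑' m : ℤ, 3 * (truncWeight N m ^ 2 * x m ^ 2) := by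
          refine ENNReal.tsum_le_tsum fun m => ?_
          rcases eq_or_ne m 0 with rfl | hm
          · simp [hb, truncWeight, truncAbs]
          · have hm0 : (m.natAbs : ℝ≥0∞) ≠ 0 := by simpa using hm
            calc _ ≤ b m ^ 2 * (3 * m.natAbs) := by gcongr; exact tsum_indicator_abs_le hm
              _ = 3 * (truncWeight N m ^ 2 * x m ^ 2) * ((m.natAbs : ℝ≥0∞)⁻¹ * m.natAbs) := by
                  simp only [hb, mul_pow, ← ENNReal.inv_pow, hroot]
                  ring
              _ = _ := by rw [ENNReal.inv_mul_cancel hm0 (ENNReal.natCast_ne_top _), mul_one]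
      _ = _ := ENNReal.tsum_mul_left
  calc ∑' n, commConv N x n ^ 2
      ≤ ∑' n, 16 * ((∑' k, y k ^ 2) * (∑' k, (χ k * x (n - k)) ^ 2) +
        (∑' k, a k ^ 2) * ∑' k, M n k ^ 2) := ENNReal.tsum_le_tsum hpt
    _ = 16 * ((∑' k, y k ^ 2) * (∑' n, ∑' k, (χ k * x (n - k)) ^ 2) +
        (∑' k, a k ^ 2) * ∑' n, ∑' k, M n k ^ 2) := by
        rw [ENNReal.tsum_mul_left, ENNReal.tsum_add, ENNReal.tsum_mul_left, ENNReal.tsum_mul_left]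
    _ ≤ _ := by
        rw [hysum, hχsum, hasum]
        gcongr

/-- If the truncated `ℓ²` weights are controlled by the quadratic convolution, uniformly in the
truncation, then the full weight is summable. -/
theorem tsum_natAbs_sq_ne_top {x : ℤ → ℝ≥0∞} (h0 : ∑' k, x k ^ 2 ≠ ⊤)
    (h1 : ∑' k : ℤ, k.natAbs * x k ^ 2 ≠ ⊤) {C D : ℝ≥0∞} (hC : C ≠ ⊤) (hD : D ≠ ⊤)
    (H : ∀ N : ℕ, ∑' k, truncWeight N k ^ 2 * x k ^ 2 ≤ C * ∑' n, commConv N x n ^ 2 + D) :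
    ∑' k : ℤ, (k.natAbs : ℝ≥0∞) ^ 2 * x k ^ 2 ≠ ⊤ := by
  have hx (k : ℤ) : x k ≠ ⊤ := fun h => ENNReal.ne_top_of_tsum_ne_top h0 k (by simp [h])
  obtain ⟨s, hs⟩ : ∃ s : Finset ℤ, (∑' k : {k // k ∉ s}, ((k : ℤ).natAbs : ℝ≥0∞) * x k ^ 2) *
      (C * 96) ≤ 1 := by
    have hlim := ENNReal.tendsto_tsum_compl_atTop_zero h1
    have hlim := ENNReal.Tendsto.mul_const (b := C * 96) hlim
      (Or.inr (ENNReal.mul_ne_top hC (by norm_num)))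
    rw [zero_mul] at hlim
    exact (hlim.eventually (Iic_mem_nhds one_pos)).exists
  set B : ℝ≥0∞ := C * (16 * ((∑ k ∈ s, (x k * k.natAbs) ^ 2) * (s.card * ∑' k, x k ^ 2))) + D
  have hB : B ≠ ⊤ := by
    refine ENNReal.add_ne_top.2 ⟨ENNReal.mul_ne_top hC (ENNReal.mul_ne_top (by norm_num)
      (ENNReal.mul_ne_top ?_ (ENNReal.mul_ne_top (ENNReal.natCast_ne_top _) h0))), hD⟩
    exact ENNReal.sum_ne_top.2 fun k _ =>
      ENNReal.pow_ne_top (ENNReal.mul_ne_top (hx k) (ENNReal.natCast_ne_top _))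
  have hunif (N : ℕ) : ∑' k, truncWeight N k ^ 2 * x k ^ 2 ≤ 2 * B := by
    set S := ∑' k, truncWeight N k ^ 2 * x k ^ 2 with hS
    have hfin : S ≠ ⊤ := by
      refine ne_top_of_le_ne_top (ENNReal.mul_ne_top (ENNReal.natCast_ne_top N) h1) ?_
      rw [hS, ← ENNReal.tsum_mul_left]
      refine ENNReal.tsum_le_tsum fun k => ?_
      rw [truncWeight_sq]
      calc _ ≤ (k.natAbs : ℝ≥0∞) * N * x k ^ 2 := by gcongr; exact min_le_right _ _
        _ = _ := by ring
    have h2 : 2 * S ≤ 2 * B + S := by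
      set ε := ∑' k : {k // k ∉ s}, ((k : ℤ).natAbs : ℝ≥0∞) * x k ^ 2
      calc 2 * S ≤ 2 * (C * ∑' n, commConv N x n ^ 2 + D) := by gcongr; exact H N
        _ ≤ 2 * (C * (16 * ((∑ k ∈ s, (x k * k.natAbs) ^ 2) * (s.card * ∑' k, x k ^ 2) +
              ε * (3 * S))) + D) := by gcongr; exact tsum_commConv_sq_le x s
        _ = 2 * B + ε * (C * 96) * S := by ring
        _ ≤ 2 * B + 1 * S := by gcongr
        _ = _ := by rw [one_mul]
    rw [two_mul S] at h2
    exact (ENNReal.add_le_add_iff_right hfin).1 h2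
  refine ne_top_of_le_ne_top (ENNReal.mul_ne_top (by norm_num : (2 : ℝ≥0∞) ≠ ⊤) hB) ?_
  rw [ENNReal.tsum_eq_iSup_sum]
  refine iSup_le fun t => ?_
  refine le_trans ?_ (hunif (t.sup Int.natAbs))
  refine le_trans (Finset.sum_le_sum fun k hk => ?_) (ENNReal.sum_le_tsum t)
  rw [truncWeight_sq, min_eq_left (by exact_mod_cast Finset.le_sup (f := Int.natAbs) hk), sq]

open AddCircle in
lemma continuous_integral_translate_mul {T : ℝ} [Fact (0 < T)] {G b : AddCircle T → ℂ} {C : ℝ}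
    (hG : Integrable G haarAddCircle) (hb : AEStronglyMeasurable b haarAddCircle)
    (hC : ∀ᵐ x ∂haarAddCircle, ‖b x‖ ≤ C) :
    Continuous fun h => ∫ x, b x * G (x + h) ∂haarAddCircle := by
  have hmp (h : AddCircle T) :
      MeasurePreserving (ContinuousMap.addRight h) haarAddCircle haarAddCircle :=
    measurePreserving_add_right haarAddCircle h
  have hint (h : AddCircle T) : Integrable (fun x => G (x + h)) haarAddCircle :=
    hG.comp_add_right h
  have hintb (h : AddCircle T) : Integrable (fun x => b x * G (x + h)) haarAddCircle :=
    (hint h).bdd_mul hb hC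
  have hcont : Continuous fun h : AddCircle T => Lp.compMeasurePreserving _ (hmp h) hG.toL1 :=
    continuous_const.compMeasurePreservingLp
      (ContinuousMap.curry ⟨fun p : AddCircle T × AddCircle T => p.2 + p.1, by fun_prop⟩).continuous
      hmp ENNReal.one_ne_top
  have hae (h : AddCircle T) :
      Lp.compMeasurePreserving _ (hmp h) hG.toL1 =ᵐ[haarAddCircle] fun x => G (x + h) :=
    (Lp.coeFn_compMeasurePreserving _ (hmp h)).trans
      ((hmp h).quasiMeasurePreserving.ae_eq_comp hG.coeFn_toL1)
  refine continuous_iff_continuousAt.2 fun h₀ => ?_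
  rw [ContinuousAt, tendsto_iff_dist_tendsto_zero]
  have hlim := ((hcont.tendsto h₀).dist (tendsto_const_nhds
    (x := Lp.compMeasurePreserving _ (hmp h₀) hG.toL1))).const_mul C
  rw [dist_self, mul_zero] at hlim
  refine squeeze_zero (fun _ => dist_nonneg) (fun h => ?_) hlim
  rw [dist_eq_norm, ← integral_sub (hintb h) (hintb h₀), L1.dist_eq_integral_dist,
    ← integral_const_mul]
  refine norm_integral_le_of_norm_le ?_ ?_
  · refine Integrable.const_mul ?_ C
    simp only [dist_eq_norm]
    exact ((L1.integrable_coeFn _).sub (L1.integrable_coeFn _)).norm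
  · filter_upwards [hC, hae h, hae h₀] with x hx h1 h2
    rw [h1, h2, ← mul_sub, norm_mul, dist_eq_norm]
    exact mul_le_mul_of_nonneg_right hx (norm_nonneg _)

open AddCircle in
/-- The convolution formula for the Fourier coefficients of a product of an integrable function
and a bounded function, when the convolution converges absolutely. -/
theorem hasSum_fourierCoeff_mul {T : ℝ} [Fact (0 < T)] {G B : AddCircle T → ℂ} {C : ℝ}
    (hG : Integrable G haarAddCircle) (hB : AEStronglyMeasurable B haarAddCircle)
    (hC : ∀ᵐ x ∂haarAddCircle, ‖B x‖ ≤ C) (n : ℤ)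
    (hs : Summable fun k => fourierCoeff G k * fourierCoeff B (n - k)) :
    HasSum (fun k => fourierCoeff G k * fourierCoeff B (n - k))
      (fourierCoeff (fun x => G x * B x) n) := by
  set b : AddCircle T → ℂ := fun x => fourier (-n) x * B x with hbdef
  have hbm : AEStronglyMeasurable b haarAddCircle :=
    (fourier (-n)).continuous.aestronglyMeasurable.mul hB
  have hbC : ∀ᵐ x ∂haarAddCircle, ‖b x‖ ≤ C := by
    filter_upwards [hC] with x hx
    rw [hbdef, norm_mul, fourier_apply, Circle.norm_coe, one_mul]
    exact hx
  have hbi : Integrable b haarAddCircle := .of_bound hbm C hbC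
  let c : C(AddCircle T, ℂ) := ⟨_, continuous_integral_translate_mul hG hbm hbC⟩
  have hcoef (k : ℤ) : fourierCoeff c k = fourierCoeff G k * fourierCoeff B (n - k) := by
    have hI : Integrable (Function.uncurry fun x h : AddCircle T => fourier (-k) h * (b x * G (x + h)))
        (haarAddCircle.prod haarAddCircle) := by
      refine Integrable.bdd_mul (c := 1) ?_ ?_ ?_
      · exact (measurePreserving_prod_add haarAddCircle haarAddCircle).integrable_comp_of_integrable
          (hbi.mul_prod hG)
      · exact (show Continuous fun p : AddCircle T × AddCircle T => fourier (-k) p.2 by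
          fun_prop).aestronglyMeasurable
      · exact .of_forall fun p => by rw [fourier_apply, Circle.norm_coe]
    calc fourierCoeff c k
        = ∫ h, ∫ x, fourier (-k) h * (b x * G (x + h)) ∂haarAddCircle ∂haarAddCircle := by
          simp only [fourierCoeff, smul_eq_mul, integral_const_mul]
          rfl
      _ = ∫ x, ∫ h, fourier (-k) h * (b x * G (x + h)) ∂haarAddCircle ∂haarAddCircle :=
          (integral_integral_swap hI).symm
      _ = ∫ x, fourierCoeff G k * (fourier (-(n - k)) x * B x) ∂haarAddCircle := by
          refine integral_congr_ae (.of_forall fun x => ?_)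
          have h1 := integral_add_left_eq_self (μ := haarAddCircle)
            (fun h => fourier (-k) (h - x) * (b x * G h)) x
          simp only [add_sub_cancel_left] at h1
          simp only [h1]
          rw [fourierCoeff, ← integral_mul_const]
          refine integral_congr_ae (.of_forall fun h => ?_)
          simp only [smul_eq_mul, hbdef]
          have h2 : fourier (-k) (h - x) = fourier (-k) h * fourier k x := by
            simp [fourier_apply, sub_eq_add_neg, AddCircle.toCircle_add]
          have h3 : fourier (-(n - k)) x = fourier (-n) x * fourier k x := by
            rw [← fourier_add]; congr 2; ring
          rw [h2, h3]
          ring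
      _ = _ := by rw [integral_const_mul]; rfl
  have hsum : Summable (fourierCoeff c) := by simpa only [← hcoef] using hs
  have h0 := has_pointwise_sum_fourier_series_of_summable hsum 0
  simp only [fourier_eval_zero, smul_eq_mul, mul_one, hcoef] at h0
  convert h0 using 1
  simp only [fourierCoeff, smul_eq_mul]
  refine integral_congr_ae (.of_forall fun x => ?_)
  simp only [hbdef, add_zero]
  ring

lemma ENNReal.sum_sq_le {ι : Type*} [Fintype ι] (f : ι → ℝ≥0∞) :
    (∑ i, f i) ^ 2 ≤ Fintype.card ι * ∑ i, f i ^ 2 := by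
  simpa [tsum_fintype, mul_comm] using ENNReal.tsum_mul_sq_le f (fun _ => 1)

lemma summable_of_tsum_enorm_ne_top {ι : Type*} {f : ι → ℂ} (h : ∑' k, ‖f k‖ₑ ≠ ⊤) :
    Summable f :=
  .of_nnnorm (ENNReal.tsum_coe_ne_top_iff_summable.1 h)

lemma summable_mul_sub {a b : ℤ → ℂ} (ha : ∑' k, ‖a k‖ₑ ^ 2 ≠ ⊤) (hb : ∑' k, ‖b k‖ₑ ^ 2 ≠ ⊤)
    (n : ℤ) : Summable fun k => a k * b (n - k) := by
  refine summable_of_tsum_enorm_ne_top fun h => ?_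
  have h1 := ENNReal.tsum_mul_sq_le (fun k => ‖a k‖ₑ) (fun k => ‖b (n - k)‖ₑ)
  simp only [enorm_mul] at h
  rw [h, ENNReal.tsum_sub_left (fun k => ‖b k‖ₑ ^ 2)] at h1
  exact ENNReal.mul_ne_top ha hb (top_le_iff.1 (by simpa using h1))

section CircleL2

variable {T : ℝ} [Fact (0 < T)]

open AddCircle

lemma tsum_enorm_fourierCoeff_sq {F : AddCircle T → ℂ} (hF : MemLp F 2 haarAddCircle) :
    ∑' k, ‖fourierCoeff F k‖ₑ ^ 2 = ∫⁻ x, ‖F x‖ₑ ^ 2 ∂haarAddCircle := by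
  have h := hasSum_sq_fourierCoeff hF.toLp
  have hc : fourierCoeff (hF.toLp : AddCircle T → ℂ) = fourierCoeff F :=
    fourierCoeff_congr_ae hF.coeFn_toLp
  have hi : ∫ t, ‖hF.toLp F t‖ ^ 2 ∂haarAddCircle = ∫ t, ‖F t‖ ^ 2 ∂haarAddCircle := by
    refine integral_congr_ae ?_
    filter_upwards [hF.coeFn_toLp] with x hx
    rw [hx]
  rw [hc, hi] at h
  have h2 : ∑' k, ENNReal.ofReal (‖fourierCoeff F k‖ ^ 2) =
      ENNReal.ofReal (∫ t, ‖F t‖ ^ 2 ∂haarAddCircle) := by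
    rw [← h.tsum_eq, ENNReal.ofReal_tsum_of_nonneg (fun _ => by positivity) h.summable]
  rw [ofReal_integral_eq_lintegral_ofReal hF.integrable_norm_pow' (.of_forall fun _ => by
    positivity)] at h2
  simpa only [ENNReal.ofReal_pow (norm_nonneg _), ofReal_norm] using h2

lemma exists_memLp_fourierCoeff_eq {c : ℤ → ℂ} (hc : ∑' k, ‖c k‖ₑ ^ 2 ≠ ⊤) :
    ∃ V : AddCircle T → ℂ, MemLp V 2 haarAddCircle ∧ ∀ k, fourierCoeff V k = c k := by
  have hs : Summable fun k => ‖c k‖ ^ 2 := by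
    have h : Summable fun k => ‖c k‖₊ ^ 2 :=
      ENNReal.tsum_coe_ne_top_iff_summable.1 (by simpa [enorm] using hc)
    simpa using NNReal.summable_coe.2 h
  have hm : Memℓp c 2 := memℓp_gen (by simpa using hs)
  refine ⟨fourierBasis.repr.symm ⟨c, hm⟩, Lp.memLp _, fun k => ?_⟩
  rw [← fourierBasis_repr, LinearIsometryEquiv.apply_symm_apply]

variable {ι : Type*} [Fintype ι] {u : ι → AddCircle T → ℝ}

lemma norm_le_one_of_sum_sq_eq_one {y : ι → ℝ} (h : ∑ i, y i ^ 2 = 1) (i : ι) :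
    ‖(y i : ℂ)‖ ≤ 1 := by
  rw [Complex.norm_real, Real.norm_eq_abs, ← sq_le_one_iff_abs_le_one, ← h]
  exact Finset.single_le_sum (f := fun i => y i ^ 2) (fun i _ => sq_nonneg _) (Finset.mem_univ i)

/-- Decomposition into components along and transversal to a unit vector. -/
lemma enorm_sq_le_normal_add_tangential {y : ι → ℝ} (h : ∑ i, y i ^ 2 = 1) (v : ι → ℂ) (j : ι) :
    ‖v j‖ₑ ^ 2 ≤ 4 * (‖∑ i, v i * y i‖ₑ ^ 2 +
      Fintype.card ι * ∑ i, ‖v j * y i - v i * y j‖ₑ ^ 2) := by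
  have hy (i : ι) : ‖(y i : ℂ)‖ₑ ≤ 1 := by
    rw [← ofReal_norm, ← ENNReal.ofReal_one]
    exact ENNReal.ofReal_le_ofReal (norm_le_one_of_sum_sq_eq_one h i)
  have h1 : v j = y j * ∑ i, v i * y i + ∑ i, y i * (v j * y i - v i * y j) := by
    have h2 : ∑ i, (y i : ℂ) ^ 2 = 1 := by exact_mod_cast h
    calc v j = (∑ i, (y i : ℂ) ^ 2) * v j := by rw [h2, one_mul]
      _ = _ := by
        rw [Finset.mul_sum, Finset.sum_mul, ← Finset.sum_add_distrib]
        exact Finset.sum_congr rfl fun i _ => by ring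
  have h3 : ‖v j‖ₑ ≤ ‖∑ i, v i * y i‖ₑ + ∑ i, ‖v j * y i - v i * y j‖ₑ := by
    conv_lhs => rw [h1]
    refine (enorm_add_le _ _).trans (add_le_add ?_ ((enorm_sum_le _ _).trans
      (Finset.sum_le_sum fun i _ => ?_)))
    · rw [enorm_mul]; exact mul_le_of_le_one_left' (hy j)
    · rw [enorm_mul]; exact mul_le_of_le_one_left' (hy i)
  calc ‖v j‖ₑ ^ 2 ≤ _ := pow_le_pow_left' h3 2
    _ ≤ _ := ENNReal.add_sq_le_four_mul _ _
    _ ≤ _ := by gcongr; exact ENNReal.sum_sq_le _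

lemma memLp_mul_of_bdd {V B : AddCircle T → ℂ} (hV : MemLp V 2 haarAddCircle)
    (hB : AEStronglyMeasurable B haarAddCircle) (hB1 : ∀ᵐ x ∂haarAddCircle, ‖B x‖ ≤ 1) :
    MemLp (fun x => V x * B x) 2 haarAddCircle := by
  refine hV.mono (hV.aestronglyMeasurable.mul hB) ?_
  filter_upwards [hB1] with x hx
  rw [norm_mul]
  exact mul_le_of_le_one_right (norm_nonneg _) hx

lemma fourierCoeff_sub {F G : AddCircle T → ℂ} (hF : Integrable F haarAddCircle)
    (hG : Integrable G haarAddCircle) (n : ℤ) :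
    fourierCoeff (fun x => F x - G x) n = fourierCoeff F n - fourierCoeff G n := by
  simp only [fourierCoeff, smul_eq_mul, mul_sub]
  exact integral_sub (hF.fourier_smul _) (hG.fourier_smul _)

lemma fourierCoeff_sum {F : ι → AddCircle T → ℂ} (hF : ∀ i, Integrable (F i) haarAddCircle)
    (n : ℤ) : fourierCoeff (fun x => ∑ i, F i x) n = ∑ i, fourierCoeff (F i) n := by
  simp only [fourierCoeff, smul_eq_mul, Finset.mul_sum]
  exact integral_finsetSum _ fun i _ => (hF i).fourier_smul _

/-- The sum over all components of the moduli of the Fourier coefficients. -/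
def fourierMass (a : ι → ℤ → ℂ) (k : ℤ) : ℝ≥0∞ := ∑ i, ‖a i k‖ₑ

lemma enorm_le_fourierMass (a : ι → ℤ → ℂ) (i : ι) (k : ℤ) : ‖a i k‖ₑ ≤ fourierMass a k :=
  Finset.single_le_sum (f := fun i => ‖a i k‖ₑ) (fun _ _ => zero_le) (Finset.mem_univ i)

lemma tsum_mul_fourierMass_sq_le (a : ι → ℤ → ℂ) (w : ℤ → ℝ≥0∞) :
    ∑' k, w k * fourierMass a k ^ 2 ≤ Fintype.card ι * ∑ i, ∑' k, w k * ‖a i k‖ₑ ^ 2 := by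
  rw [← Summable.tsum_finsetSum fun _ _ => ENNReal.summable, ← ENNReal.tsum_mul_left]
  refine ENNReal.tsum_le_tsum fun k => ?_
  rw [← Finset.mul_sum, mul_left_comm]
  gcongr
  exact ENNReal.sum_sq_le _

lemma enorm_symbol_le {N : ℕ} {c : ℝ} (hc : 0 ≤ c) {m : ℤ → ℝ} {n : ℤ}
    (hm : ∀ k : ℤ, |m k| ≤ c * min (truncAbs N k) (truncAbs N (n - k : ℤ)))
    {s : ℤ → ℂ} {X : ℤ → ℝ≥0∞} (hs : ∀ k, ‖s k‖ₑ ≤ X k * X (n - k)) :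
    ‖∑' k, (m k : ℂ) * s k‖ₑ ≤ ENNReal.ofReal c * commConv N X n := by
  refine enorm_tsum_le_tsum_enorm.trans ?_
  rw [commConv, ← ENNReal.tsum_mul_left]
  refine ENNReal.tsum_le_tsum fun k => ?_
  have h1 : ‖(m k : ℂ)‖ₑ ≤ ENNReal.ofReal c * min (truncWeight N k) (truncWeight N (n - k)) := by
    rw [truncWeight, truncWeight, ← ENNReal.ofReal_min, ← ENNReal.ofReal_mul hc, ← ofReal_norm,
      Complex.norm_real, Real.norm_eq_abs]
    exact ENNReal.ofReal_le_ofReal (hm k)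
  rw [enorm_mul]
  calc _ ≤ _ := mul_le_mul' h1 (hs k)
    _ = _ := by ring

lemma tsum_fourierCoeff_sphere_ne_top (hum : ∀ i, AEStronglyMeasurable (fun x => (u i x : ℂ)) haarAddCircle)
    (hu1 : ∀ᵐ x ∂haarAddCircle, ∑ i, u i x ^ 2 = 1) (i : ι) :
    ∑' k, ‖fourierCoeff (fun x => (u i x : ℂ)) k‖ₑ ^ 2 ≠ ⊤ := by
  have hb : ∀ᵐ x ∂haarAddCircle, ‖(u i x : ℂ)‖ ≤ 1 := by
    filter_upwards [hu1] with x hx using norm_le_one_of_sum_sq_eq_one hx i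
  have hm : MemLp (fun x => (u i x : ℂ)) 2 haarAddCircle := .of_bound (hum i) 1 hb
  rw [tsum_enorm_fourierCoeff_sq hm]
  have h := hm.eLpNorm_lt_top
  rw [eLpNorm_lt_top_iff_lintegral_rpow_enorm_lt_top (by norm_num) (by norm_num)] at h
  simpa using h.ne

lemma enorm_fourierCoeff_normal_le {N : ℕ}
    (hum : ∀ i, AEStronglyMeasurable (fun x => (u i x : ℂ)) haarAddCircle)
    (hu1 : ∀ᵐ x ∂haarAddCircle, ∑ i, u i x ^ 2 = 1) {V : ι → AddCircle T → ℂ}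
    (hV : ∀ i, MemLp (V i) 2 haarAddCircle)
    (hVs : ∀ i, ∑' k, ‖fourierCoeff (V i) k‖ₑ ^ 2 ≠ ⊤)
    (hVc : ∀ i k, fourierCoeff (V i) k = truncAbs N k * fourierCoeff (fun x => (u i x : ℂ)) k)
    (n : ℤ) :
    ‖fourierCoeff (fun x => ∑ i, V i x * u i x) n‖ₑ ≤
      commConv N (fourierMass fun i => fourierCoeff fun x => (u i x : ℂ)) n := by
  have hb (i : ι) : ∀ᵐ x ∂haarAddCircle, ‖(u i x : ℂ)‖ ≤ 1 := by
    filter_upwards [hu1] with x hx using norm_le_one_of_sum_sq_eq_one hx i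
  have hus := tsum_fourierCoeff_sphere_ne_top hum hu1
  have hUi (i : ι) : Integrable (fun x => (u i x : ℂ)) haarAddCircle := .of_bound (hum i) 1 (hb i)
  set a : ι → ℤ → ℂ := fun i => fourierCoeff fun x => (u i x : ℂ) with ha
  set s : ℤ → ℂ := fun k => ∑ i, a i k * a i (n - k) with hs
  set P := fourierCoeff (fun x => ∑ i, V i x * u i x) n with hP
  have h1 : HasSum (fun k : ℤ => (truncAbs N k : ℂ) * s k) P := by
    have h := hasSum_sum (s := Finset.univ) fun i _ => hasSum_fourierCoeff_mul
      ((hV i).integrable (by norm_num)) (hum i) (hb i) n (summable_mul_sub (hVs i) (hus i) n)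
    rw [← fourierCoeff_sum fun i =>
      (memLp_mul_of_bdd (hV i) (hum i) (hb i)).integrable (by norm_num)] at h
    refine h.congr_fun fun k => ?_
    rw [hs, Finset.mul_sum]
    exact Finset.sum_congr rfl fun i _ => by rw [hVc, mul_assoc]
  have h2 : HasSum (fun k : ℤ => (truncAbs N (n - k : ℤ) : ℂ) * s k) P := by
    refine ((Equiv.subLeft n).hasSum_iff.2 h1).congr_fun fun k => ?_
    simp only [Function.comp, Equiv.subLeft_apply, hs, sub_sub_cancel]
    congr 1
    exact Finset.sum_congr rfl fun i _ => mul_comm _ _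
  have h3 : HasSum (fun k : ℤ => (truncAbs N n : ℂ) * s k) 0 := by
    have h := hasSum_sum (s := Finset.univ) fun i _ => hasSum_fourierCoeff_mul
      (hUi i) (hum i) (hb i) n (summable_mul_sub (hus i) (hus i) n)
    rw [← fourierCoeff_sum fun i => (hUi i).bdd_mul (hum i) (hb i)] at h
    have h4 : fourierCoeff (fun x => ∑ i, (u i x : ℂ) * u i x) n =
        fourierCoeff (fourier (T := T) 0) n := by
      refine congr_fun (fourierCoeff_congr_ae ?_) n
      filter_upwards [hu1] with x hx
      rw [fourier_zero]
      exact_mod_cast by simpa [sq] using hx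
    rw [h4, fourierCoeff_fourier] at h
    have h7 : (truncAbs N n : ℂ) * (Pi.single 0 1 : ℤ → ℂ) n = 0 := by
      rcases eq_or_ne n 0 with rfl | hn
      · simp [truncAbs]
      · simp [Pi.single_eq_of_ne hn]
    have h8 := h.mul_left (truncAbs N n : ℂ)
    rw [h7] at h8
    exact h8
  have h5 := (h1.add h2).sub h3
  have h6 : ‖P + P‖ₑ ≤ ENNReal.ofReal 2 * commConv N (fourierMass a) n := by
    rw [← sub_zero (P + P), ← h5.tsum_eq]
    simp only [← add_mul, ← sub_mul]
    simp only [← Complex.ofReal_add, ← Complex.ofReal_sub]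
    refine enorm_symbol_le zero_le_two (fun k => ?_) fun k => ?_
    · have h := abs_truncAbs_add_sub_le (Nat.cast_nonneg N) (k : ℝ) (n - k : ℤ)
      push_cast at h ⊢
      rwa [add_sub_cancel] at h
    · refine (enorm_sum_le _ _).trans ?_
      rw [fourierMass, Finset.sum_mul]
      refine Finset.sum_le_sum fun i _ => ?_
      rw [enorm_mul]
      exact mul_le_mul_right (enorm_le_fourierMass a i _) _
  rw [← two_mul, enorm_mul, ← ofReal_norm, Complex.norm_ofNat] at h6
  exact (ENNReal.mul_le_mul_iff_right (by norm_num) (by norm_num)).1 h6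

lemma enorm_fourierCoeff_tangential_le {N : ℕ}
    (hum : ∀ i, AEStronglyMeasurable (fun x => (u i x : ℂ)) haarAddCircle)
    (hu1 : ∀ᵐ x ∂haarAddCircle, ∑ i, u i x ^ 2 = 1) {V : ι → AddCircle T → ℂ}
    (hV : ∀ i, MemLp (V i) 2 haarAddCircle)
    (hVs : ∀ i, ∑' k, ‖fourierCoeff (V i) k‖ₑ ^ 2 ≠ ⊤)
    (hVc : ∀ i k, fourierCoeff (V i) k = truncAbs N k * fourierCoeff (fun x => (u i x : ℂ)) k)
    (n : ℤ) {i j : ι} {A : ℂ}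
    (hA : HasSum (fun k : ℤ => ((|(n - k : ℤ)| - |k| : ℝ) : ℂ) *
      (fourierCoeff (fun x => (u i x : ℂ)) k * fourierCoeff (fun x => (u j x : ℂ)) (n - k))) A) :
    ‖fourierCoeff (fun x => V j x * u i x - V i x * u j x) n‖ₑ ≤
      3 * commConv N (fourierMass fun i => fourierCoeff fun x => (u i x : ℂ)) n + ‖A‖ₑ := by
  have hb (i : ι) : ∀ᵐ x ∂haarAddCircle, ‖(u i x : ℂ)‖ ≤ 1 := by
    filter_upwards [hu1] with x hx using norm_le_one_of_sum_sq_eq_one hx i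
  have hus := tsum_fourierCoeff_sphere_ne_top hum hu1
  have hVu (i j : ι) : Integrable (fun x => V i x * u j x) haarAddCircle :=
    (memLp_mul_of_bdd (hV i) (hum j) (hb j)).integrable (by norm_num)
  rw [fourierCoeff_sub (hVu j i) (hVu i j)]
  have hsum (i j : ι) := hasSum_fourierCoeff_mul
      ((hV i).integrable (by norm_num)) (hum j) (hb j) n (summable_mul_sub (hVs i) (hus j) n)
  have h1 := (Equiv.subLeft n).hasSum_iff.2 (hsum j i)
  have h2 := hsum i j
  set a : ι → ℤ → ℂ := fun i => fourierCoeff fun x => (u i x : ℂ) with ha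
  set θ : ℝ := truncAbs N n / |(n : ℝ)| with hθ
  have h3 := (h1.sub h2).sub (hA.mul_left (θ : ℂ))
  set P := fourierCoeff (fun x => V j x * u i x) n - fourierCoeff (fun x => V i x * u j x) n
  have h4 : ‖P - θ * A‖ₑ ≤ ENNReal.ofReal 3 * commConv N (fourierMass a) n := by
    have h5 : HasSum (fun k : ℤ => ((truncAbs N (n - k : ℤ) - truncAbs N k -
        θ * (|(n - k : ℤ)| - |k|) : ℝ) : ℂ) * (a i k * a j (n - k))) (P - θ * A) := by
      refine h3.congr_fun fun k => ?_
      simp only [Function.comp, Equiv.subLeft_apply, sub_sub_cancel, hVc, ha]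
      push_cast
      ring
    rw [← h5.tsum_eq]
    refine enorm_symbol_le zero_le_three (fun k => ?_) fun k => ?_
    · have h := abs_truncAbs_sub_sub_le (Nat.cast_nonneg N) (k : ℝ) (n - k : ℤ)
      push_cast at h ⊢
      rwa [add_sub_cancel] at h
    · rw [enorm_mul]
      exact mul_le_mul' (enorm_le_fourierMass a i _) (enorm_le_fourierMass a j _)
  have hθ1 : ‖(θ : ℂ)‖ₑ ≤ 1 := by
    rw [← ofReal_norm, Complex.norm_real, Real.norm_eq_abs, ← ENNReal.ofReal_one,
      abs_of_nonneg (div_nonneg (truncAbs_nonneg _ _) (abs_nonneg _))]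
    exact ENNReal.ofReal_le_ofReal (div_le_one_of_le₀ (truncAbs_le_abs _) (abs_nonneg _))
  calc ‖P‖ₑ = ‖P - θ * A + θ * A‖ₑ := by rw [sub_add_cancel]
    _ ≤ ‖P - θ * A‖ₑ + ‖θ * A‖ₑ := enorm_add_le _ _
    _ ≤ _ := by
      refine add_le_add (h4.trans_eq (by simp)) ?_
      rw [enorm_mul]
      exact mul_le_of_le_one_left' hθ1

/-- Regularity of a sphere-valued map on the circle whose commutator coefficients
`∑ (|m| - |k|) û_i(k) û_j(m)`, `k + m = n`, are square summable in `n`. -/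
theorem tsum_natAbs_sq_fourierCoeff_ne_top
    (hum : ∀ i, AEStronglyMeasurable (fun x => (u i x : ℂ)) haarAddCircle)
    (hu1 : ∀ᵐ x ∂haarAddCircle, ∑ i, u i x ^ 2 = 1)
    (hu2 : ∀ i, ∑' k : ℤ, k.natAbs * ‖fourierCoeff (fun x => (u i x : ℂ)) k‖ₑ ^ 2 ≠ ⊤)
    {A : ι → ι → ℤ → ℂ} (hA2 : ∀ i j, ∑' n, ‖A i j n‖ₑ ^ 2 ≠ ⊤)
    (hA : ∀ i j n, HasSum (fun k : ℤ => ((|(n - k : ℤ)| - |k| : ℝ) : ℂ) *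
      (fourierCoeff (fun x => (u i x : ℂ)) k * fourierCoeff (fun x => (u j x : ℂ)) (n - k)))
      (A i j n)) (i : ι) :
    ∑' k : ℤ, (k.natAbs : ℝ≥0∞) ^ 2 * ‖fourierCoeff (fun x => (u i x : ℂ)) k‖ₑ ^ 2 ≠ ⊤ := by
  have hus := tsum_fourierCoeff_sphere_ne_top hum hu1
  set a : ι → ℤ → ℂ := fun i => fourierCoeff fun x => (u i x : ℂ) with ha
  have hcard : (Fintype.card ι : ℝ≥0∞) ≠ ⊤ := ENNReal.natCast_ne_top _
  have h0 : ∑' k, fourierMass a k ^ 2 ≠ ⊤ := by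
    have h := tsum_mul_fourierMass_sq_le a 1
    simp only [Pi.one_apply, one_mul] at h
    exact ne_top_of_le_ne_top (ENNReal.mul_ne_top hcard (ENNReal.sum_ne_top.2 fun i _ => hus i)) h
  have h1 : ∑' k : ℤ, k.natAbs * fourierMass a k ^ 2 ≠ ⊤ :=
    ne_top_of_le_ne_top (ENNReal.mul_ne_top hcard (ENNReal.sum_ne_top.2 fun i _ => hu2 i))
      (tsum_mul_fourierMass_sq_le a _)
  set d := (Fintype.card ι : ℝ≥0∞)
  have hmain (N : ℕ) (j : ι) : ∑' k, truncWeight N k ^ 2 * ‖a j k‖ₑ ^ 2 ≤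
      4 * (∑' n, commConv N (fourierMass a) n ^ 2 + d * ∑ i, (36 *
        ∑' n, commConv N (fourierMass a) n ^ 2 + 4 * ∑' n, ‖A i j n‖ₑ ^ 2)) := by
    have hμ (j : ι) (k : ℤ) :
        ‖(truncAbs N k : ℂ) * a j k‖ₑ ^ 2 = truncWeight N k ^ 2 * ‖a j k‖ₑ ^ 2 := by
      rw [enorm_mul, mul_pow, truncWeight, ← ofReal_norm (truncAbs N k : ℂ), Complex.norm_real,
        Real.norm_eq_abs, abs_of_nonneg (truncAbs_nonneg _ _)]
    have hcs (j : ι) : ∑' k : ℤ, ‖(truncAbs N k : ℂ) * a j k‖ₑ ^ 2 ≠ ⊤ := by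
      refine ne_top_of_le_ne_top (ENNReal.mul_ne_top (ENNReal.natCast_ne_top N) (hu2 j)) ?_
      rw [← ENNReal.tsum_mul_left]
      refine ENNReal.tsum_le_tsum fun k => ?_
      rw [hμ, truncWeight_sq]
      calc _ ≤ (k.natAbs : ℝ≥0∞) * N * ‖a j k‖ₑ ^ 2 := by gcongr; exact min_le_right _ _
        _ = _ := by ring
    choose V hV hVc using fun j => exists_memLp_fourierCoeff_eq (T := T) (hcs j)
    have hVs (j : ι) : ∑' k, ‖fourierCoeff (V j) k‖ₑ ^ 2 ≠ ⊤ := by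
      simpa only [hVc] using hcs j
    have hb (i : ι) : ∀ᵐ x ∂haarAddCircle, ‖(u i x : ℂ)‖ ≤ 1 := by
      filter_upwards [hu1] with x hx using norm_le_one_of_sum_sq_eq_one hx i
    have hVu (i j : ι) : MemLp (fun x => V i x * u j x) 2 haarAddCircle :=
      memLp_mul_of_bdd (hV i) (hum j) (hb j)
    have hP : MemLp (fun x => ∑ i, V i x * u i x) 2 haarAddCircle :=
      memLp_finsetSum _ fun i _ => hVu i i
    have hW (i : ι) : MemLp (fun x => V j x * u i x - V i x * u j x) 2 haarAddCircle :=
      (hVu j i).sub (hVu i j)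
    calc ∑' k, truncWeight N k ^ 2 * ‖a j k‖ₑ ^ 2
        = ∫⁻ x, ‖V j x‖ₑ ^ 2 ∂haarAddCircle := by
          rw [← tsum_enorm_fourierCoeff_sq (hV j)]
          simp only [hVc, hμ]
      _ ≤ ∫⁻ x, 4 * (‖∑ i, V i x * u i x‖ₑ ^ 2 +
            d * ∑ i, ‖V j x * u i x - V i x * u j x‖ₑ ^ 2) ∂haarAddCircle := by
          refine lintegral_mono_ae ?_
          filter_upwards [hu1] with x hx
          exact enorm_sq_le_normal_add_tangential (y := fun i => u i x) hx (fun i => V i x) j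
      _ = 4 * (∑' n, ‖fourierCoeff (fun x => ∑ i, V i x * u i x) n‖ₑ ^ 2 + d * ∑ i,
            ∑' n, ‖fourierCoeff (fun x => V j x * u i x - V i x * u j x) n‖ₑ ^ 2) := by
          have hWm (i : ι) : AEMeasurable (fun x => ‖V j x * u i x - V i x * u j x‖ₑ ^ 2)
              haarAddCircle := (hW i).aestronglyMeasurable.enorm.pow_const 2
          rw [lintegral_const_mul' _ _ (by norm_num),
            lintegral_add_left' (hP.aestronglyMeasurable.enorm.pow_const 2),
            lintegral_const_mul' _ _ hcard, lintegral_finsetSum' _ fun i _ => hWm i]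
          simp only [tsum_enorm_fourierCoeff_sq hP, tsum_enorm_fourierCoeff_sq (hW _)]
      _ ≤ _ := by
          gcongr with n i
          · exact enorm_fourierCoeff_normal_le hum hu1 hV hVs hVc n
          · rw [← ENNReal.tsum_mul_left, ← ENNReal.tsum_mul_left, ← ENNReal.tsum_add]
            refine ENNReal.tsum_le_tsum fun n => ?_
            calc _ ≤ (3 * commConv N (fourierMass a) n + ‖A i j n‖ₑ) ^ 2 :=
                  pow_le_pow_left' (enorm_fourierCoeff_tangential_le hum hu1 hV hVs hVc n
                    (hA i j n)) 2
              _ ≤ _ := ENNReal.add_sq_le_four_mul _ _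
              _ = _ := by ring
  have h2 : ∑' k : ℤ, (k.natAbs : ℝ≥0∞) ^ 2 * fourierMass a k ^ 2 ≠ ⊤ := by
    refine tsum_natAbs_sq_ne_top h0 h1 (C := d * (d * (4 * (1 + d * (d * 36)))))
      (D := d * ∑ j, (4 * (d * ∑ i, 4 * ∑' n, ‖A i j n‖ₑ ^ 2))) ?_ ?_ fun N => ?_
    · finiteness
    · exact ENNReal.mul_ne_top hcard (ENNReal.sum_ne_top.2 fun j _ => ENNReal.mul_ne_top
        (by norm_num) (ENNReal.mul_ne_top hcard (ENNReal.sum_ne_top.2 fun i _ =>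
        ENNReal.mul_ne_top (by norm_num) (hA2 i j))))
    · refine (tsum_mul_fourierMass_sq_le a _).trans ?_
      calc _ ≤ d * ∑ j, _ := mul_le_mul_right (Finset.sum_le_sum fun j _ => hmain N j) d
        _ = _ := by
          simp only [Finset.sum_add_distrib, mul_add, Finset.sum_const, Finset.card_univ,
            nsmul_eq_mul]
          ring
  refine ne_top_of_le_ne_top h2 (ENNReal.tsum_le_tsum fun k => ?_)
  gcongr
  exact enorm_le_fourierMass a i k

end CircleL2

section CircleEnergy

variable {T : ℝ}

open AddCircle

lemma fourier_add_apply (k : ℤ) (x h : AddCircle T) :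
    fourier k (x + h) = fourier k x * fourier k h := by
  simp [fourier_apply, AddCircle.toCircle_add]

lemma norm_one_sub_fourier_neg (k : ℤ) (h : AddCircle T) :
    ‖(1 : ℂ) - fourier (-k) h‖ = ‖(1 : ℂ) - fourier k h‖ := by
  rw [fourier_neg, ← Complex.norm_conj]
  simp

lemma fourier_natCast_eq_pow (m : ℕ) (h : AddCircle T) :
    fourier (m : ℤ) h = (fourier 1 h : ℂ) ^ m := by
  simp [fourier_apply, toCircle_nsmul]

lemma norm_one_sub_fourier_natAbs (k : ℤ) (h : AddCircle T) :
    ‖(1 : ℂ) - fourier k h‖ = ‖∑ j ∈ Finset.range k.natAbs, fourier (j : ℤ) h‖ *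
      ‖(1 : ℂ) - fourier 1 h‖ := by
  have h1 : ‖(1 : ℂ) - fourier k h‖ = ‖(1 : ℂ) - fourier (k.natAbs : ℤ) h‖ := by
    rcases Int.natAbs_eq k with hk | hk
    · rw [← hk]
    · conv_lhs => rw [hk, norm_one_sub_fourier_neg]
  rw [h1, ← norm_mul]
  congr 1
  simp only [fourier_natCast_eq_pow]
  rw [geom_sum_mul_neg]

lemma norm_fourier_one_sub (x h : AddCircle T) :
    ‖(fourier 1 x : ℂ) - fourier 1 (x + h)‖ = ‖(1 : ℂ) - fourier 1 h‖ := by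
  rw [fourier_add_apply, ← mul_one_sub, norm_mul, fourier_apply, Circle.norm_coe, one_mul]

lemma norm_one_sub_fourier_le (k : ℤ) (h : AddCircle T) :
    ‖(1 : ℂ) - fourier k h‖ ≤ k.natAbs * ‖(1 : ℂ) - fourier 1 h‖ := by
  rw [norm_one_sub_fourier_natAbs]
  refine mul_le_mul_of_nonneg_right ?_ (norm_nonneg _)
  refine (norm_sum_le _ _).trans ?_
  simp only [fourier_apply, Circle.norm_coe, Finset.sum_const, Finset.card_range, nsmul_eq_mul,
    mul_one, le_refl]

variable [Fact (0 < T)]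

lemma ae_haarAddCircle_ne_zero : ∀ᵐ h : AddCircle T ∂haarAddCircle, h ≠ 0 := by
  have hT : 0 < T := Fact.out
  have h1 : (volume : Measure (AddCircle T)) {0} = 0 := by
    rw [← Metric.closedBall_zero, AddCircle.volume_closedBall]
    simp [hT.le]
  rw [volume_eq_smul_haarAddCircle, Measure.smul_apply, smul_eq_mul, mul_eq_zero] at h1
  exact measure_eq_zero_iff_ae_notMem.1 (h1.resolve_left (by simpa using hT))

lemma fourier_one_ne_one {h : AddCircle T} (hh : h ≠ 0) : (1 : ℂ) - fourier 1 h ≠ 0 := by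
  intro h0
  refine hh (injective_toCircle (Fact.out : 0 < T).ne' ?_)
  rw [toCircle_zero]
  rw [fourier_one, sub_eq_zero] at h0
  exact Circle.ext h0.symm

lemma lintegral_fourier_kernel (k : ℤ) :
    ∫⁻ h : AddCircle T, ‖((1 : ℂ) - fourier k h) / ((1 : ℂ) - fourier 1 h)‖ₑ ^ 2 ∂haarAddCircle =
      k.natAbs := by
  set D : C(AddCircle T, ℂ) := ∑ j ∈ Finset.range k.natAbs, fourier (j : ℤ) with hD
  have hDm : MemLp D 2 haarAddCircle :=
    .of_bound D.continuous.aestronglyMeasurable ‖D‖ (.of_forall D.norm_coe_le_norm)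
  have h1 : ∫⁻ h : AddCircle T,
      ‖((1 : ℂ) - fourier k h) / ((1 : ℂ) - fourier 1 h)‖ₑ ^ 2 ∂haarAddCircle =
      ∫⁻ h, ‖D h‖ₑ ^ 2 ∂haarAddCircle := by
    refine lintegral_congr_ae ?_
    filter_upwards [ae_haarAddCircle_ne_zero (T := T)] with h hh
    have h2 := fourier_one_ne_one hh
    congr 1
    rw [← ofReal_norm, ← ofReal_norm, norm_div, norm_one_sub_fourier_natAbs,
      mul_div_cancel_right₀ _ (norm_ne_zero_iff.2 h2), hD, ContinuousMap.sum_apply]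
  have hco (m : ℤ) : fourierCoeff D m = if m ∈ (Finset.range k.natAbs).image (Nat.cast : ℕ → ℤ)
      then 1 else 0 := by
    have h3 : fourierCoeff D m = ∑ j ∈ Finset.range k.natAbs, (Pi.single (j : ℤ) 1 : ℤ → ℂ) m := by
      simp only [← fourierCoeff_fourier (T := T)]
      rw [hD, ContinuousMap.coe_sum]
      simp only [fourierCoeff, smul_eq_mul, Finset.sum_apply, Finset.mul_sum]
      refine integral_finsetSum _ fun j _ => Integrable.fourier_smul ?_ _
      exact (fourier (T := T) (j : ℤ)).continuous.integrable_of_hasCompactSupport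
        (HasCompactSupport.of_compactSpace _)
    rw [h3, ← Finset.sum_image (f := fun j : ℤ => (Pi.single j 1 : ℤ → ℂ) m)
      (fun a _ b _ h => by exact_mod_cast h), Finset.sum_pi_single]
  rw [h1, ← tsum_enorm_fourierCoeff_sq hDm]
  simp only [hco]
  rw [tsum_eq_sum (s := (Finset.range k.natAbs).image (Nat.cast : ℕ → ℤ))
    (fun m hm => by simp only [if_neg hm]; simp)]
  rw [Finset.sum_congr rfl (g := fun _ => 1) fun m hm => by simp only [if_pos hm]; simp]
  rw [Finset.sum_const, Finset.card_image_of_injective _ Nat.cast_injective, Finset.card_range]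
  simp

lemma fourierCoeff_translate (F : AddCircle T → ℂ) (h : AddCircle T) (k : ℤ) :
    fourierCoeff (fun x => F (x + h)) k = fourier k h * fourierCoeff F k := by
  have h1 := integral_add_right_eq_self (μ := haarAddCircle)
    (fun x => fourier (-k) (x - h) * F x) h
  simp only [add_sub_cancel_right] at h1
  simp only [fourierCoeff, smul_eq_mul, h1, ← integral_const_mul]
  refine integral_congr_ae (.of_forall fun x => ?_)
  have h2 : fourier (-k) (x - h) = fourier (-k) x * fourier k h := by
    simp [fourier_apply, sub_eq_add_neg, AddCircle.toCircle_add]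
  simp only [h2]
  ring

lemma lintegral_diff_quotient {F : AddCircle T → ℂ} (hF : MemLp F 2 haarAddCircle) :
    ∫⁻ h, ∫⁻ x, ‖(F x - F (x + h)) / ((1 : ℂ) - fourier 1 h)‖ₑ ^ 2 ∂haarAddCircle ∂haarAddCircle =
      ∑' k : ℤ, k.natAbs * ‖fourierCoeff F k‖ₑ ^ 2 := by
  have hmp (h : AddCircle T) : MeasurePreserving (· + h) haarAddCircle haarAddCircle :=
    measurePreserving_add_right haarAddCircle h
  have hFh (h : AddCircle T) : MemLp (fun x => F (x + h)) 2 haarAddCircle :=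
    hF.comp_measurePreserving (hmp h)
  have h1 (h : AddCircle T) :
      ∫⁻ x, ‖(F x - F (x + h)) / ((1 : ℂ) - fourier 1 h)‖ₑ ^ 2 ∂haarAddCircle =
      ∑' k : ℤ, ‖fourierCoeff F k‖ₑ ^ 2 *
        ‖((1 : ℂ) - fourier k h) / ((1 : ℂ) - fourier 1 h)‖ₑ ^ 2 := by
    have hm : MemLp (fun x => (F x - F (x + h)) / ((1 : ℂ) - fourier 1 h)) 2 haarAddCircle := by
      simp only [div_eq_mul_inv, mul_comm _ ((1 : ℂ) - fourier 1 h)⁻¹]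
      exact (hF.sub (hFh h)).const_mul _
    rw [← tsum_enorm_fourierCoeff_sq hm]
    refine tsum_congr fun k => ?_
    rw [← mul_pow, ← enorm_mul]
    congr 2
    simp only [div_eq_mul_inv, mul_comm _ ((1 : ℂ) - fourier 1 h)⁻¹]
    rw [fourierCoeff.const_mul, fourierCoeff_sub (hF.integrable (by norm_num))
      ((hFh h).integrable (by norm_num)), fourierCoeff_translate]
    ring
  simp only [h1]
  have hc (k : ℤ) : Continuous fun h : AddCircle T => fourier k h := (fourier k).continuous
  have hmeas (k : ℤ) : Measurable fun h : AddCircle T => ‖fourierCoeff F k‖ₑ ^ 2 *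
      ‖((1 : ℂ) - fourier k h) / ((1 : ℂ) - fourier 1 h)‖ₑ ^ 2 := by
    have := (hc k).measurable
    have := (hc 1).measurable
    fun_prop
  rw [lintegral_tsum fun k => (hmeas k).aemeasurable]
  refine tsum_congr fun k => ?_
  rw [lintegral_const_mul' _ _ (by finiteness), lintegral_fourier_kernel, mul_comm]

lemma memLp_diff_quotient {F : AddCircle T → ℂ} (hFm : Measurable F) (hF : MemLp F 2 haarAddCircle)
    (hs : ∑' k : ℤ, k.natAbs * ‖fourierCoeff F k‖ₑ ^ 2 ≠ ⊤) :
    MemLp (fun p : AddCircle T × AddCircle T => (F p.1 - F (p.1 + p.2)) / ((1 : ℂ) - fourier 1 p.2))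
      2 (haarAddCircle.prod haarAddCircle) := by
  have hm : Measurable fun p : AddCircle T × AddCircle T =>
      (F p.1 - F (p.1 + p.2)) / ((1 : ℂ) - fourier 1 p.2) := by
    have := (fourier (T := T) 1).continuous.measurable
    fun_prop
  refine ⟨hm.aestronglyMeasurable, ?_⟩
  rw [eLpNorm_lt_top_iff_lintegral_rpow_enorm_lt_top (by norm_num) (by norm_num)]
  simp only [ENNReal.toReal_ofNat, ENNReal.rpow_two]
  rw [lintegral_prod_symm _ (hm.enorm.pow_const 2).aemeasurable, lintegral_diff_quotient hF]
  exact hs.lt_top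

lemma integral_translate {E : Type*} [NormedAddCommGroup E] [NormedSpace ℝ E]
    (F : AddCircle T → E) (x : AddCircle T) :
    ∫ y, F y ∂haarAddCircle = ∫ h, F (x + h) ∂haarAddCircle :=
  (integral_add_left_eq_self F x).symm

lemma integrable_energy_density {ι : Type*} [Fintype ι] {u : ι → AddCircle T → ℝ}
    (hum : ∀ i, Measurable (u i)) (hu : ∀ i, MemLp (fun x => (u i x : ℂ)) 2 haarAddCircle)
    (hs : ∀ i, ∑' k : ℤ, k.natAbs * ‖fourierCoeff (fun x => (u i x : ℂ)) k‖ₑ ^ 2 ≠ ⊤) :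
    Integrable (fun x => ∫ y, (∑ i, (u i x - u i y) ^ 2) /
      ‖(fourier 1 x : ℂ) - fourier 1 y‖ ^ 2 ∂haarAddCircle) haarAddCircle := by
  have h1 : Integrable (fun p : AddCircle T × AddCircle T => ∑ i,
      ‖((u i p.1 : ℂ) - u i (p.1 + p.2)) / ((1 : ℂ) - fourier 1 p.2)‖ ^ 2)
      (haarAddCircle.prod haarAddCircle) :=
    integrable_finsetSum _ fun i _ => (memLp_diff_quotient
      (Complex.measurable_ofReal.comp (hum i)) (hu i) (hs i)).integrable_norm_pow'
  refine h1.integral_prod_left.congr (.of_forall fun x => ?_)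
  simp only
  conv_rhs => rw [integral_translate _ x]
  refine integral_congr_ae (.of_forall fun h => ?_)
  simp only [norm_fourier_one_sub, norm_div, div_pow, ← Complex.ofReal_sub, Complex.norm_real,
    Real.norm_eq_abs, sq_abs, Finset.sum_div]

lemma integral_fourier_kernel (k : ℤ) :
    ∫ h : AddCircle T, ‖(1 : ℂ) - fourier k h‖ ^ 2 / ‖(1 : ℂ) - fourier 1 h‖ ^ 2 ∂haarAddCircle =
      |(k : ℝ)| := by
  have hm (k : ℤ) : Measurable fun h : AddCircle T => fourier k h :=
    (fourier k).continuous.measurable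
  have := hm k
  have := hm 1
  rw [integral_eq_lintegral_of_nonneg_ae (.of_forall fun h => by positivity)
    (Measurable.aestronglyMeasurable (by fun_prop))]
  have h1 (h : AddCircle T) :
      ENNReal.ofReal (‖(1 : ℂ) - fourier k h‖ ^ 2 / ‖(1 : ℂ) - fourier 1 h‖ ^ 2) =
      ‖((1 : ℂ) - fourier k h) / ((1 : ℂ) - fourier 1 h)‖ₑ ^ 2 := by
    rw [← ofReal_norm, ← ENNReal.ofReal_pow (norm_nonneg _), norm_div, div_pow]
  simp only [h1, lintegral_fourier_kernel, ENNReal.toReal_natCast, Nat.cast_natAbs, Int.cast_abs]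

lemma integrable_pairing_kernel {F : AddCircle T → ℂ} (hFm : Measurable F)
    (hF : MemLp F 2 haarAddCircle)
    (hs : ∑' k : ℤ, k.natAbs * ‖fourierCoeff F k‖ₑ ^ 2 ≠ ⊤) (m : ℤ) :
    Integrable (fun p : AddCircle T × AddCircle T => (F p.1 - F (p.1 + p.2)) * (fourier m p.1 *
      (1 - fourier m p.2)) / (‖(1 : ℂ) - fourier 1 p.2‖ : ℂ) ^ 2)
      (haarAddCircle.prod haarAddCircle) := by
  have hm (k : ℤ) : Measurable fun h : AddCircle T => fourier k h :=
    (fourier k).continuous.measurable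
  have h1 : Measurable fun p : AddCircle T × AddCircle T => fourier m p.1 *
      ((1 - fourier m p.2) / (starRingEnd ℂ) ((1 : ℂ) - fourier 1 p.2)) := by
    have := hm m
    have := hm 1
    have : Measurable (starRingEnd ℂ) := Complex.continuous_conj.measurable
    fun_prop
  have h2 := ((memLp_diff_quotient hFm hF hs).integrable (by norm_num)).bdd_mul (c := m.natAbs)
    h1.aestronglyMeasurable (.of_forall fun p => ?_)
  · refine h2.congr (.of_forall fun p => ?_)
    simp only
    rw [← Complex.mul_conj', mul_comm, mul_div_assoc, ← mul_div_assoc, div_mul_eq_mul_div]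
    simp only [div_eq_mul_inv, mul_inv]
    ring
  · rw [norm_mul, norm_div, fourier_apply, Circle.norm_coe, one_mul, Complex.norm_conj]
    exact div_le_of_le_mul₀ (norm_nonneg _) (Nat.cast_nonneg _) (norm_one_sub_fourier_le m p.2)

/-- The weak form of the half Laplacian acts on characters as the Fourier multiplier `|m|`. -/
lemma integral_pairing_fourier {F : AddCircle T → ℂ} (hFm : Measurable F)
    (hF : MemLp F 2 haarAddCircle)
    (hs : ∑' k : ℤ, k.natAbs * ‖fourierCoeff F k‖ₑ ^ 2 ≠ ⊤) (m : ℤ) (L : ℂ →L[ℝ] ℝ) :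
    ∫ x, ∫ y, L ((F x - F y) * (fourier (-m) x - fourier (-m) y) /
      (‖(fourier 1 x : ℂ) - fourier 1 y‖ : ℂ) ^ 2) ∂haarAddCircle ∂haarAddCircle =
      L (((|(m : ℝ)| : ℝ) : ℂ) * fourierCoeff F m) := by
  set K : AddCircle T → AddCircle T → ℂ := fun x h => (F x - F (x + h)) * (fourier (-m) x *
    (1 - fourier (-m) h)) / (‖(1 : ℂ) - fourier 1 h‖ : ℂ) ^ 2 with hK
  have hKi : Integrable (Function.uncurry K) (haarAddCircle.prod haarAddCircle) :=
    integrable_pairing_kernel hFm hF hs (-m)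
  have hFh (h : AddCircle T) : MemLp (fun x => F (x + h)) 2 haarAddCircle :=
    hF.comp_measurePreserving (measurePreserving_add_right haarAddCircle h)
  have h0 : ∫ x, ∫ h, K x h ∂haarAddCircle ∂haarAddCircle =
      ((|(m : ℝ)| : ℝ) : ℂ) * fourierCoeff F m :=
    calc _ = ∫ h, ∫ x, K x h ∂haarAddCircle ∂haarAddCircle := integral_integral_swap hKi
      _ = ∫ h : AddCircle T,
            ((‖(1 : ℂ) - fourier m h‖ ^ 2 / ‖(1 : ℂ) - fourier 1 h‖ ^ 2 : ℝ) : ℂ) *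
            fourierCoeff F m ∂haarAddCircle := by
          refine integral_congr_ae (.of_forall fun h => ?_)
          have h1 := fourierCoeff_sub (hF.integrable (by norm_num))
            ((hFh h).integrable (by norm_num)) m
          rw [fourierCoeff_translate, fourierCoeff] at h1
          have h2 (x : AddCircle T) : K x h =
              (1 - fourier (-m) h) / (‖(1 : ℂ) - fourier 1 h‖ : ℂ) ^ 2 *
              (fourier (-m) x • (F x - F (x + h))) := by
            simp only [hK, smul_eq_mul]
            ring
          simp only [h2]
          rw [integral_const_mul, h1, ← one_sub_mul, ← mul_assoc]
          congr 1
          push_cast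
          rw [← Complex.mul_conj' ((1 : ℂ) - fourier m h), map_sub, map_one, ← fourier_neg]
          ring
      _ = _ := by rw [integral_mul_const, integral_complex_ofReal, integral_fourier_kernel]
  rw [← h0]
  refine Eq.trans ?_ (L.integral_comp_comm hKi.integral_prod_left)
  refine integral_congr_ae ?_
  filter_upwards [hKi.prod_right_ae] with x hx
  refine Eq.trans ?_ (L.integral_comp_comm hx)
  rw [integral_translate _ x]
  refine integral_congr_ae (.of_forall fun h => ?_)
  simp only [norm_fourier_one_sub, hK, fourier_add_apply (-m), ← mul_one_sub]

end CircleEnergy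

section EulerLagrange

variable {T : ℝ} [Fact (0 < T)]

open AddCircle

lemma tsum_enorm_sqrt_weight_sq_ne_top {a : ℤ → ℂ} (ha : ∑' k, ‖a k‖ₑ ^ 2 ≠ ⊤)
    (ha' : ∑' k : ℤ, k.natAbs * ‖a k‖ₑ ^ 2 ≠ ⊤) :
    ∑' k : ℤ, ‖((√(1 + |(k : ℝ)|) : ℝ) : ℂ) * a k‖ₑ ^ 2 ≠ ⊤ := by
  have h (k : ℤ) : ‖((√(1 + |(k : ℝ)|) : ℝ) : ℂ) * a k‖ₑ ^ 2 =
      ‖a k‖ₑ ^ 2 + k.natAbs * ‖a k‖ₑ ^ 2 := by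
    have h1 : ‖((√(1 + |(k : ℝ)|) : ℝ) : ℂ)‖ₑ ^ 2 = 1 + (k.natAbs : ℝ≥0∞) := by
      rw [← ofReal_norm, ← ENNReal.ofReal_pow (norm_nonneg _), Complex.norm_real, Real.norm_eq_abs,
        sq_abs, Real.sq_sqrt (by positivity), ENNReal.ofReal_add zero_le_one (abs_nonneg _),
        ENNReal.ofReal_one, ← Int.cast_abs, ← Nat.cast_natAbs, ENNReal.ofReal_natCast]
    rw [enorm_mul, mul_pow, h1, add_mul, one_mul]
  simp only [h]
  rw [ENNReal.tsum_add]
  exact ENNReal.add_ne_top.2 ⟨ha, ha'⟩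

lemma summable_abs_mul_sub {a b : ℤ → ℂ} (ha : ∑' k, ‖a k‖ₑ ^ 2 ≠ ⊤)
    (ha' : ∑' k : ℤ, k.natAbs * ‖a k‖ₑ ^ 2 ≠ ⊤) (hb : ∑' k, ‖b k‖ₑ ^ 2 ≠ ⊤)
    (hb' : ∑' k : ℤ, k.natAbs * ‖b k‖ₑ ^ 2 ≠ ⊤) (n : ℤ) :
    Summable fun k : ℤ => ((|(k : ℝ)| : ℝ) : ℂ) * a k * b (n - k) := by
  refine .of_norm_bounded ((summable_mul_sub (tsum_enorm_sqrt_weight_sq_ne_top ha ha')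
    (tsum_enorm_sqrt_weight_sq_ne_top hb hb') n).norm.mul_left √(1 + |(n : ℝ)|)) fun k => ?_
  simp only [norm_mul, Complex.norm_real, Real.norm_eq_abs, abs_abs, abs_of_nonneg (sqrt_nonneg _)]
  have h1 : |(k : ℝ)| ≤ √(1 + |(n : ℝ)|) * √(1 + |(k : ℝ)|) * √(1 + |((n - k : ℤ) : ℝ)|) := by
    rw [← Real.sqrt_mul (by positivity), ← Real.sqrt_mul (by positivity)]
    refine Real.le_sqrt_of_sq_le ?_
    have h2 : |(k : ℝ)| ≤ |(n : ℝ)| + |((n - k : ℤ) : ℝ)| := by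
      have := abs_sub (n : ℝ) ((n - k : ℤ) : ℝ)
      rwa [Int.cast_sub, sub_sub_cancel, ← Int.cast_sub] at this
    nlinarith [abs_nonneg (k : ℝ), abs_nonneg (n : ℝ), abs_nonneg ((n - k : ℤ) : ℝ),
      mul_nonneg (abs_nonneg (n : ℝ)) (abs_nonneg ((n - k : ℤ) : ℝ)),
      mul_nonneg (mul_nonneg (abs_nonneg (n : ℝ)) (abs_nonneg ((n - k : ℤ) : ℝ)))
        (abs_nonneg (k : ℝ))]
  calc _ = |(k : ℝ)| * (‖a k‖ * ‖b (n - k)‖) := by ring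
    _ ≤ √(1 + |(n : ℝ)|) * √(1 + |(k : ℝ)|) * √(1 + |((n - k : ℤ) : ℝ)|) *
          (‖a k‖ * ‖b (n - k)‖) := by gcongr
    _ = _ := by ring

/-- A sphere-valued `H^{1/2}` map on the circle solving `c |D| u = g u + f` with `f ∈ L²`
has its derivative in `L²`: the scalar multiplier `g` disappears from `u ∧ |D| u`. -/
lemma tsum_natAbs_sq_fourierCoeff_ne_top_of_multiplier {ι : Type*} [Fintype ι]
    {u f : ι → AddCircle T → ℝ} {g : AddCircle T → ℝ} {c : ℂ} (hc : c ≠ 0)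
    (hum : ∀ i, AEStronglyMeasurable (fun x => (u i x : ℂ)) haarAddCircle)
    (hu1 : ∀ᵐ x ∂haarAddCircle, ∑ i, u i x ^ 2 = 1)
    (hu2 : ∀ i, ∑' k : ℤ, k.natAbs * ‖fourierCoeff (fun x => (u i x : ℂ)) k‖ₑ ^ 2 ≠ ⊤)
    (hf : ∀ i, MemLp (fun x => (f i x : ℂ)) 2 haarAddCircle)
    (hg : Integrable (fun x => (g x : ℂ)) haarAddCircle)
    (hG : ∀ i m, fourierCoeff (fun x => (g x : ℂ) * u i x + f i x) m =
      c * (((|(m : ℝ)| : ℝ) : ℂ) * fourierCoeff (fun x => (u i x : ℂ)) m)) (i : ι) :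
    ∑' k : ℤ, (k.natAbs : ℝ≥0∞) ^ 2 * ‖fourierCoeff (fun x => (u i x : ℂ)) k‖ₑ ^ 2 ≠ ⊤ := by
  have hu0 := tsum_fourierCoeff_sphere_ne_top hum hu1
  have hb (i : ι) : ∀ᵐ x ∂haarAddCircle, ‖(u i x : ℂ)‖ ≤ 1 := by
    filter_upwards [hu1] with x hx using norm_le_one_of_sum_sq_eq_one hx i
  have hGi (i : ι) : Integrable (fun x => (g x : ℂ) * u i x + f i x) haarAddCircle :=
    ((hg.bdd_mul (hum i) (hb i)).congr (.of_forall fun x => mul_comm _ _)).add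
      ((hf i).integrable (by norm_num))
  have hsum (i j : ι) (n : ℤ) :=
    hasSum_fourierCoeff_mul (hGi j) (hum i) (hb i) n (by
      simp only [hG, mul_assoc]
      simpa only [mul_assoc] using (summable_abs_mul_sub (hu0 j) (hu2 j) (hu0 i) (hu2 i) n).mul_left c)
  have hfu (i j : ι) : MemLp (fun x => (f j x : ℂ) * u i x - f i x * u j x) 2 haarAddCircle :=
    (memLp_mul_of_bdd (hf j) (hum i) (hb i)).sub (memLp_mul_of_bdd (hf i) (hum j) (hb j))
  have hGu (i j : ι) : Integrable (fun x => ((g x : ℂ) * u j x + f j x) * u i x) haarAddCircle :=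
    ((hGi j).bdd_mul (hum i) (hb i)).congr (.of_forall fun x => mul_comm _ _)
  refine tsum_natAbs_sq_fourierCoeff_ne_top hum hu1 hu2 (A := fun i j n =>
    c⁻¹ * fourierCoeff (fun x => (f j x : ℂ) * u i x - f i x * u j x) n) (fun i j => ?_)
    (fun i j n => ?_) i
  · simp only [enorm_mul, mul_pow]
    rw [ENNReal.tsum_mul_left, tsum_enorm_fourierCoeff_sq (hfu i j)]
    refine ENNReal.mul_ne_top (by finiteness) ?_
    have := (hfu i j).2
    rw [eLpNorm_lt_top_iff_lintegral_rpow_enorm_lt_top (by norm_num) (by norm_num)] at this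
    simpa using this.ne
  · have h1 := ((Equiv.subLeft n).hasSum_iff.2 (hsum i j n)).sub (hsum j i n)
    have h2 : fourierCoeff (fun x => (f j x : ℂ) * u i x - f i x * u j x) n =
        fourierCoeff (fun x => ((g x : ℂ) * u j x + f j x) * u i x) n -
        fourierCoeff (fun x => ((g x : ℂ) * u i x + f i x) * u j x) n := by
      rw [← fourierCoeff_sub (hGu i j) (hGu j i)]
      congr 1
      funext x
      ring
    rw [h2]
    refine (h1.mul_left c⁻¹).congr_fun fun k => ?_
    simp only [Function.comp_apply, Equiv.subLeft_apply, sub_sub_cancel, hG]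
    field_simp
    push_cast
    ring

end EulerLagrange

section Transfer

open AddCircle

instance fact_two_pi_pos : Fact (0 < 2 * π) := ⟨Real.two_pi_pos⟩

lemma circ_eq : circ = Set.Ioc (-π) (-π + 2 * π) := by
  rw [circ]
  congr 1
  ring

lemma setIntegral_circ {V : Type*} [NormedAddCommGroup V] [NormedSpace ℝ V]
    (F : AddCircle (2 * π) → V) :
    ∫ x in circ, F x = (2 * π) • ∫ x, F x ∂haarAddCircle := by
  rw [circ_eq, AddCircle.integral_preimage, integral_haarAddCircle,
    smul_inv_smul₀ Real.two_pi_pos.ne']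

lemma setLIntegral_circ (F : AddCircle (2 * π) → ℝ≥0∞) :
    ∫⁻ x in circ, F x = ENNReal.ofReal (2 * π) * ∫⁻ x, F x ∂haarAddCircle := by
  rw [circ_eq, AddCircle.lintegral_preimage, volume_eq_smul_haarAddCircle, lintegral_smul_measure,
    smul_eq_mul]

lemma ae_haarAddCircle_of_ae_circ {p : AddCircle (2 * π) → Prop} (hp : MeasurableSet {x | p x})
    (h : ∀ᵐ x : ℝ ∂volume.restrict circ, p x) : ∀ᵐ x ∂haarAddCircle, p x := by
  have h1 : ∀ᵐ x : AddCircle (2 * π), p x := by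
    rw [← (AddCircle.measurePreserving_mk (2 * π) (-π)).map_eq,
      ae_map_iff (AddCircle.measurePreserving_mk (2 * π) (-π)).aemeasurable hp, ← circ_eq]
    exact h
  rwa [volume_eq_smul_haarAddCircle, Measure.ae_ennreal_smul_measure_iff
    (by simpa using Real.two_pi_pos)] at h1

lemma measurable_periodic_lift {V : Type*} [MeasurableSpace V] {F : ℝ → V}
    (hF : Measurable F) (hp : Function.Periodic F (2 * π)) :
    Measurable (hp.lift : AddCircle (2 * π) → V) :=
  measurable_from_quotient.2 hF

lemma fourier_coe_two_pi (k : ℤ) (x : ℝ) :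
    fourier k (x : AddCircle (2 * π)) = Complex.exp (Complex.I * k * x) := by
  rw [fourier_coe_apply]
  congr 1
  have : (π : ℂ) ≠ 0 := by exact_mod_cast Real.pi_ne_zero
  push_cast
  field_simp

lemma fc_coe (F : AddCircle (2 * π) → ℂ) (k : ℤ) : fc (fun x => F x) k = fourierCoeff F k := by
  rw [fourierCoeff, fc]
  have h : ∫ x, fourier (-k) x • F x ∂haarAddCircle =
      (2 * π)⁻¹ • ∫ x in circ, fourier (-k) (x : AddCircle (2 * π)) • F x := by
    rw [setIntegral_circ fun x => fourier (-k) x • F x, inv_smul_smul₀ Real.two_pi_pos.ne']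
  rw [h, Complex.real_smul, one_div]
  congr 1
  refine integral_congr_ae (.of_forall fun x => ?_)
  simp only [fourier_coe_two_pi, smul_eq_mul]
  rw [mul_comm]
  congr 2
  push_cast
  ring

lemma cd_eq (x y : ℝ) :
    cd x y = ‖(fourier 1 (x : AddCircle (2 * π)) : ℂ) - fourier 1 (y : AddCircle (2 * π))‖ := by
  have h : (fourier 1 (x : AddCircle (2 * π)) : ℂ) - fourier 1 (y : AddCircle (2 * π)) =
      fourier 1 (y : AddCircle (2 * π)) * (Complex.exp (Complex.I * (x - y : ℝ)) - 1) := by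
    simp only [fourier_coe_two_pi, mul_sub, ← Complex.exp_add]
    push_cast
    ring_nf
  rw [h, norm_mul, fourier_apply, Circle.norm_coe, one_mul, Complex.norm_exp_I_mul_ofReal_sub_one,
    cd, norm_mul, Real.norm_eq_abs, Real.norm_eq_abs, abs_two]

lemma contDiff_fourier_coe (k : ℤ) :
    ContDiff ℝ (⊤ : ℕ∞) fun x : ℝ => (fourier k (x : AddCircle (2 * π)) : ℂ) := by
  simp only [fourier_coe_two_pi]
  have := Complex.ofRealCLM.contDiff (n := (⊤ : ℕ∞))
  exact (contDiff_const.mul this).cexp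

lemma integral_energy_density_circ {n : ℕ} (U : AddCircle (2 * π) → E n) (x : ℝ) :
    gagl (fun y : ℝ => U y) x = 2 * π * ∫ y, (∑ i, (U x i - U y i) ^ 2) /
      ‖(fourier 1 (x : AddCircle (2 * π)) : ℂ) - fourier 1 y‖ ^ 2 ∂haarAddCircle := by
  simp only [gagl, cd_eq]
  exact setIntegral_circ fun y => (∑ i, (U x i - U y i) ^ 2) /
    ‖(fourier 1 (x : AddCircle (2 * π)) : ℂ) - fourier 1 y‖ ^ 2

lemma pairing_character {n : ℕ} (U : AddCircle (2 * π) → E n) (j : Fin n) (m : ℤ)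
    (L : ℂ →L[ℝ] ℝ) :
    pairing (fun x : ℝ => U x) (fun x : ℝ => L (fourier (-m) (x : AddCircle (2 * π))) •
      EuclideanSpace.single j 1) = (2 * π) * ((2 * π) *
      ∫ x, ∫ y, L (((U x j : ℂ) - U y j) * (fourier (-m) x - fourier (-m) y) /
        (‖(fourier 1 x : ℂ) - fourier 1 y‖ : ℂ) ^ 2) ∂haarAddCircle ∂haarAddCircle) := by
  have h (x y : AddCircle (2 * π)) : (∑ i, (U x i - U y i) *
      ((L (fourier (-m) x) • EuclideanSpace.single j (1 : ℝ) : E n) i -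
        (L (fourier (-m) y) • EuclideanSpace.single j (1 : ℝ) : E n) i)) /
        ‖(fourier 1 x : ℂ) - fourier 1 y‖ ^ 2 =
      L (((U x j : ℂ) - U y j) * (fourier (-m) x - fourier (-m) y) /
        (‖(fourier 1 x : ℂ) - fourier 1 y‖ : ℂ) ^ 2) := by
    rw [← Complex.ofReal_sub, ← Complex.ofReal_pow, mul_div_right_comm, ← Complex.ofReal_div,
      ← Complex.real_smul, L.map_smul, map_sub, Finset.sum_eq_single j]
    · simp
      ring
    · intro i _ hi
      simp [hi]
    · simp
  have h' (x : AddCircle (2 * π)) : ∫ y : ℝ in circ, L (((U x j : ℂ) - U y j) *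
      (fourier (-m) x - fourier (-m) y) / (‖(fourier 1 x : ℂ) - fourier 1 y‖ : ℂ) ^ 2) =
      2 * π * ∫ y, L (((U x j : ℂ) - U y j) * (fourier (-m) x - fourier (-m) y) /
        (‖(fourier 1 x : ℂ) - fourier 1 y‖ : ℂ) ^ 2) ∂haarAddCircle :=
    setIntegral_circ (V := ℝ) fun y => L (((U x j : ℂ) - U y j) *
      (fourier (-m) x - fourier (-m) y) / (‖(fourier 1 x : ℂ) - fourier 1 y‖ : ℂ) ^ 2)
  simp only [pairing, cd_eq, h, h']
  rw [setIntegral_circ (V := ℝ) fun x => 2 * π * ∫ y, L (((U x j : ℂ) - U y j) *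
    (fourier (-m) x - fourier (-m) y) / (‖(fourier 1 x : ℂ) - fourier 1 y‖ : ℂ) ^ 2)
      ∂haarAddCircle, smul_eq_mul, integral_const_mul]

/-- Testing the equation against characters identifies the Fourier coefficients of its right-hand
side. -/
lemma fourierCoeff_eq_of_pairing {n : ℕ} {U F : AddCircle (2 * π) → E n} {g : AddCircle (2 * π) → ℝ}
    (hUm : Measurable U) (hU : ∀ j, MemLp (fun x => (U x j : ℂ)) 2 haarAddCircle)
    (hs : ∀ j, ∑' k : ℤ, k.natAbs * ‖fourierCoeff (fun x => (U x j : ℂ)) k‖ₑ ^ 2 ≠ ⊤)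
    (hG : ∀ j, Integrable (fun x => (g x : ℂ) * U x j + F x j) haarAddCircle)
    (heq : ∀ φ : ℝ → E n, ContDiff ℝ (⊤ : ℕ∞) φ → Function.Periodic φ (2 * π) →
      pairing (fun x : ℝ => U x) φ = ∫ x : ℝ in circ, ∑ i, (g x * U x i + F x i) * φ x i)
    (j : Fin n) (m : ℤ) :
    fourierCoeff (fun x => (g x : ℂ) * U x j + F x j) m =
      ((2 * π : ℝ) : ℂ) * (((|(m : ℝ)| : ℝ) : ℂ) * fourierCoeff (fun x => (U x j : ℂ)) m) := by
  have key (L : ℂ →L[ℝ] ℝ) : L (fourierCoeff (fun x => (g x : ℂ) * U x j + F x j) m) =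
      L (((2 * π : ℝ) : ℂ) *
        (((|(m : ℝ)| : ℝ) : ℂ) * fourierCoeff (fun x => (U x j : ℂ)) m)) := by
    have h1 := heq (fun x : ℝ => L (fourier (-m) (x : AddCircle (2 * π))) •
      EuclideanSpace.single j 1) ((L.contDiff.comp (contDiff_fourier_coe (-m))).smul contDiff_const)
      (fun x => by simp only [AddCircle.coe_add_period])
    have hUj : Measurable fun x => (U x j : ℂ) := by fun_prop
    rw [pairing_character, integral_pairing_fourier hUj (hU j) (hs j)] at h1
    have h2 (x : AddCircle (2 * π)) : ∑ i, (g x * U x i + F x i) *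
        (L (fourier (-m) x) • EuclideanSpace.single j (1 : ℝ) : E n) i =
        L (fourier (-m) x • ((g x : ℂ) * U x j + F x j)) := by
      rw [← Complex.ofReal_mul, ← Complex.ofReal_add, smul_eq_mul, mul_comm (fourier (-m) x),
        ← Complex.real_smul, L.map_smul, Finset.sum_eq_single j]
      · simp
      · intro i _ hi
        simp [hi]
      · simp
    simp only [h2] at h1
    rw [setIntegral_circ fun x => L (fourier (-m) x • ((g x : ℂ) * U x j + F x j)), smul_eq_mul,
      L.integral_comp_comm ((hG j).fourier_smul (-m))] at h1
    rw [← Complex.real_smul, L.map_smul, smul_eq_mul, fourierCoeff]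
    exact (mul_left_cancel₀ Real.two_pi_pos.ne' h1).symm
  exact Complex.ext (key Complex.reCLM) (key Complex.imCLM)

end Transfer

/-- Improved regularity: a sphere-valued `H^{1/2}` solution of
`(-Δ)^{1/2}u = u|d_{1/2}u|² + f` with `f ∈ L²` belongs to `H¹(S¹)`. -/
theorem improved_regularity (n : ℕ) (hn : 2 ≤ n) (u f : ℝ → E n)
    (hum : Measurable u) (hup : Function.Periodic u (2 * π))
    (hus : ∀ᵐ x ∂(volume.restrict circ), ‖u x‖ = 1)
    (hue : hHalf u < ⊤)
    (hfm : Measurable f) (hfp : Function.Periodic f (2 * π))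
    (hf2 : (∫⁻ x in circ, (‖f x‖₊ : ℝ≥0∞) ^ 2) < ⊤)
    (heq : ∀ φ : ℝ → E n, ContDiff ℝ (⊤ : ℕ∞) φ → Function.Periodic φ (2 * π) →
      pairing u φ = ∫ x in circ, ∑ i, (gagl u x * u x i + f x i) * φ x i) :
    hSob 1 u < ⊤ := by
  classical
  obtain ⟨U, rfl⟩ : ∃ U : AddCircle (2 * π) → E n, u = fun x : ℝ => U x := ⟨hup.lift, rfl⟩
  obtain ⟨F, rfl⟩ : ∃ F : AddCircle (2 * π) → E n, f = fun x : ℝ => F x := ⟨hfp.lift, rfl⟩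
  have hUm : Measurable U := measurable_periodic_lift hum hup
  have hFm : Measurable F := measurable_periodic_lift hfm hfp
  have hUj (j : Fin n) : Measurable fun x => (U x j : ℂ) := by fun_prop
  have hFj (j : Fin n) : Measurable fun x => (F x j : ℂ) := by fun_prop
  have hsph : ∀ᵐ x ∂AddCircle.haarAddCircle, ∑ i, U x i ^ 2 = 1 := by
    have h1 : ∀ᵐ x ∂AddCircle.haarAddCircle, ‖U x‖ = 1 :=
      ae_haarAddCircle_of_ae_circ (measurableSet_eq_fun hUm.norm measurable_const) hus
    filter_upwards [h1] with x hx
    rw [← EuclideanSpace.real_norm_sq_eq, hx, one_pow]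
  have hcoeff (k : ℤ) (i : Fin n) :
      fcV (fun x : ℝ => U x) k i = fourierCoeff (fun x => (U x i : ℂ)) k :=
    fc_coe (fun x => (U x i : ℂ)) k
  simp only [hHalf, hSob, hcoeff, ← enorm_eq_nnnorm] at hue ⊢
  have hs (j : Fin n) :
      ∑' k : ℤ, k.natAbs * ‖fourierCoeff (fun x => (U x j : ℂ)) k‖ₑ ^ 2 ≠ ⊤ := by
    refine ne_top_of_le_ne_top hue.ne (ENNReal.tsum_le_tsum fun k => ?_)
    gcongr
    exact Finset.single_le_sum (f := fun i => ‖fourierCoeff (fun x => (U x i : ℂ)) k‖ₑ ^ 2)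
      (fun _ _ => zero_le) (Finset.mem_univ j)
  have hU (j : Fin n) : MemLp (fun x => (U x j : ℂ)) 2 AddCircle.haarAddCircle := by
    refine .of_bound (hUj j).aestronglyMeasurable 1 ?_
    filter_upwards [hsph] with x hx using norm_le_one_of_sum_sq_eq_one hx j
  have hF (j : Fin n) : MemLp (fun x => (F x j : ℂ)) 2 AddCircle.haarAddCircle := by
    refine ⟨(hFj j).aestronglyMeasurable, ?_⟩
    rw [eLpNorm_lt_top_iff_lintegral_rpow_enorm_lt_top (by norm_num) (by norm_num)]
    simp only [ENNReal.toReal_ofNat, ENNReal.rpow_two]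
    simp only [← enorm_eq_nnnorm] at hf2
    rw [setLIntegral_circ fun x => ‖F x‖ₑ ^ 2] at hf2
    refine lt_of_le_of_lt (lintegral_mono fun x => ?_)
      (ENNReal.lt_top_of_mul_ne_top_right hf2.ne (by simpa using Real.pi_pos))
    gcongr
    rw [← ofReal_norm, ← ofReal_norm, Complex.norm_real]
    exact ENNReal.ofReal_le_ofReal (PiLp.norm_apply_le (F x) j)
  set g : AddCircle (2 * π) → ℝ := fun x => 2 * π * ∫ y, (∑ i, (U x i - U y i) ^ 2) /
    ‖(fourier 1 x : ℂ) - fourier 1 y‖ ^ 2 ∂AddCircle.haarAddCircle with hg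
  have hgi : Integrable (fun x => (g x : ℂ)) AddCircle.haarAddCircle :=
    ((integrable_energy_density (u := fun i x => U x i) (fun i => by fun_prop) hU hs).const_mul
      (2 * π)).ofReal
  simp only [integral_energy_density_circ U] at heq
  have hG (j : Fin n) : Integrable (fun x => (g x : ℂ) * U x j + F x j) AddCircle.haarAddCircle := by
    refine Integrable.add ?_ ((hF j).integrable (by norm_num))
    refine (hgi.bdd_mul (c := 1) (hUj j).aestronglyMeasurable ?_).congr
      (.of_forall fun x => mul_comm _ _)
    filter_upwards [hsph] with x hx using norm_le_one_of_sum_sq_eq_one hx j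
  have h0 := tsum_fourierCoeff_sphere_ne_top (u := fun i x => U x i)
    (fun i => (hUj i).aestronglyMeasurable) hsph
  have h1 := tsum_natAbs_sq_fourierCoeff_ne_top_of_multiplier (u := fun i x => U x i)
    (f := fun i x => F x i) (g := g) (c := ((2 * π : ℝ) : ℂ))
    (by exact_mod_cast Real.two_pi_pos.ne') (fun i => (hUj i).aestronglyMeasurable) hsph hs hF hgi
    (fourierCoeff_eq_of_pairing hUm hU hs hG heq)
  have hw (k : ℤ) : ENNReal.ofReal ((1 + (k : ℝ) ^ 2) ^ (1 : ℝ)) =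
      1 + (k.natAbs : ℝ≥0∞) ^ 2 := by
    rw [Real.rpow_one, ENNReal.ofReal_add zero_le_one (sq_nonneg _), ENNReal.ofReal_one, ← sq_abs,
      ENNReal.ofReal_pow (abs_nonneg _), ← Int.cast_abs, ← Nat.cast_natAbs, ENNReal.ofReal_natCast]
  simp only [hw, Finset.mul_sum, add_mul, one_mul]
  rw [Summable.tsum_finsetSum fun i _ => ENNReal.summable]
  simp only [ENNReal.tsum_add]
  exact ENNReal.sum_lt_top.2 fun i _ => ENNReal.add_lt_top.2 ⟨(h0 i).lt_top, (h1 i).lt_top⟩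
end
end

section
/- Let u, v : S¹ → ℝ be trigonometric polynomials (all but finitely many Fourier coefficients vanish), and define g : S¹ → ℂ by g(x) := ∫_{S¹} (u(x)−u(y))(v(x)−v(y))/|x−y|² dy, i.e. g = d_{1/2}u · d_{1/2}v. Then for every n ∈ ℤ, the n-th Fourier coefficient of g satisfies ĝ(n) = Σ_{j∈ℤ} C(j, n−j) û(j) v̂(n−j), where C(j,k) := ∫_{−π}^{π} (e^{ijh}−1)(e^{ikh}−1)/(4 sin²(h/2)) dh. -/
open MeasureTheory Real Filter
open scoped BigOperators ENNReal Real Topology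

noncomputable section

lemma abs_sin_natCast_mul_le (n : ℕ) (t : ℝ) : |Real.sin (n * t)| ≤ n * |Real.sin t| := by
  induction n with
  | zero => simp
  | succ n ih =>
    have h : Real.sin ((n + 1 : ℕ) * t)
        = Real.sin (n * t) * Real.cos t + Real.cos (n * t) * Real.sin t := by
      rw [← Real.sin_add]; congr 1; push_cast; ring
    calc |Real.sin ((n + 1 : ℕ) * t)|
        ≤ |Real.sin (n * t)| * |Real.cos t| + |Real.cos (n * t)| * |Real.sin t| := by
          rw [h, ← abs_mul, ← abs_mul]; exact abs_add_le _ _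
      _ ≤ |Real.sin (n * t)| * 1 + 1 * |Real.sin t| := by
          gcongr
          · exact Real.abs_cos_le_one _
          · exact Real.abs_cos_le_one _
      _ ≤ (n + 1 : ℕ) * |Real.sin t| := by push_cast; linarith

lemma abs_sin_intCast_mul_le (j : ℤ) (t : ℝ) : |Real.sin (j * t)| ≤ |(j : ℝ)| * |Real.sin t| := by
  rcases Int.eq_nat_or_neg j with ⟨n, rfl | rfl⟩
  · simpa using abs_sin_natCast_mul_le n t
  · simpa using abs_sin_natCast_mul_le n t

lemma norm_exp_sub_one_le (j : ℤ) (h : ℝ) :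
    ‖Complex.exp (Complex.I * (j : ℂ) * (h : ℂ)) - 1‖ ≤ 2 * (|(j : ℝ)| * |Real.sin (h / 2)|) := by
  have e : Complex.I * (j : ℂ) * (h : ℂ) = Complex.I * ((j * h : ℝ) : ℂ) := by push_cast; ring
  rw [e, Complex.norm_exp_I_mul_ofReal_sub_one, norm_mul, Real.norm_two, Real.norm_eq_abs,
    mul_div_assoc]
  gcongr
  exact abs_sin_intCast_mul_le j (h / 2)

/-- The integrand of `Cjk`. -/
def cKernel (j k : ℤ) (h : ℝ) : ℂ :=
  (Complex.exp (Complex.I * (j : ℂ) * (h : ℂ)) - 1)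
      * (Complex.exp (Complex.I * (k : ℂ) * (h : ℂ)) - 1)
      / ((4 * Real.sin (h / 2) ^ 2 : ℝ) : ℂ)

lemma norm_cKernel_le (j k : ℤ) (h : ℝ) : ‖cKernel j k h‖ ≤ |(j : ℝ)| * |(k : ℝ)| := by
  rw [cKernel, norm_div, norm_mul, Complex.norm_real, Real.norm_of_nonneg (by positivity)]
  refine div_le_of_le_mul₀ (by positivity) (by positivity) ?_
  calc _ ≤ 2 * (|(j : ℝ)| * |Real.sin (h / 2)|) * (2 * (|(k : ℝ)| * |Real.sin (h / 2)|)) := by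
        gcongr <;> exact norm_exp_sub_one_le _ _
    _ = _ := by rw [← sq_abs (Real.sin (h / 2))]; ring

lemma measurable_cKernel (j k : ℤ) : Measurable (cKernel j k) := by
  unfold cKernel; fun_prop

lemma exp_int_periodic (j : ℤ) (h : ℝ) :
    Complex.exp (Complex.I * (j : ℂ) * ((h + 2 * π : ℝ) : ℂ))
      = Complex.exp (Complex.I * (j : ℂ) * (h : ℂ)) := by
  rw [Complex.exp_eq_exp_iff_exists_int]
  exact ⟨j, by push_cast; ring⟩

lemma cKernel_periodic (j k : ℤ) : Function.Periodic (cKernel j k) (2 * π) := by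
  intro h
  have hs : Real.sin ((h + 2 * π) / 2) = -Real.sin (h / 2) := by
    rw [← Real.sin_add_pi]; congr 1; ring
  simp only [cKernel, exp_int_periodic, hs, neg_sq]

lemma integral_circ (f : ℝ → ℂ) : ∫ x in circ, f x = ∫ x in (-π)..π, f x := by
  rw [circ, intervalIntegral.integral_of_le (by linarith [Real.pi_pos])]

lemma integrableOn_circ_of_bounded {f : ℝ → ℂ} (hf : Measurable f) (C : ℝ)
    (hC : ∀ x, ‖f x‖ ≤ C) : IntegrableOn f circ := by
  refine Measure.integrableOn_of_bounded (M := C) ?_ hf.aestronglyMeasurable (ae_of_all _ hC)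
  simp [circ]

lemma integral_cKernel_sub (j k : ℤ) (x : ℝ) :
    ∫ y in circ, cKernel j k (y - x) = Cjk j k := by
  change _ = ∫ h in circ, cKernel j k h
  rw [integral_circ, integral_circ,
    intervalIntegral.integral_comp_sub_right (fun h => cKernel j k h) x]
  have := (cKernel_periodic j k).intervalIntegral_add_eq (-π - x) (-π)
  convert this using 2 <;> ring

lemma norm_exp_I_mul_int_mul (n : ℤ) (x : ℝ) :
    ‖Complex.exp (Complex.I * (n : ℂ) * (x : ℂ))‖ = 1 := by
  have e : Complex.I * (n : ℂ) * (x : ℂ) = ((n * x : ℝ) : ℂ) * Complex.I := by push_cast; ring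
  rw [e, Complex.norm_exp_ofReal_mul_I]

lemma integral_circ_exp (n : ℤ) :
    ∫ x in circ, Complex.exp (Complex.I * (n : ℂ) * (x : ℂ)) = if n = 0 then 2 * (π : ℂ) else 0 := by
  rw [integral_circ]
  split_ifs with h
  · subst h; simp; ring
  · rw [integral_exp_mul_complex (by simp [h]), div_eq_zero_iff]
    left
    rw [← exp_int_periodic n (-π), show -π + 2 * π = π by ring, sub_self]

/-- Fourier coefficients of a finite sum of exponentials. -/
lemma fc_sum_exp {ι : Type*} (s : Finset ι) (c : ι → ℂ) (m : ι → ℤ) (n : ℤ) :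
    fc (fun x => ∑ i ∈ s, c i * Complex.exp (Complex.I * (m i : ℂ) * (x : ℂ))) n
      = ∑ i ∈ s, if m i = n then c i else 0 := by
  have e : ∀ x : ℝ, (∑ i ∈ s, c i * Complex.exp (Complex.I * (m i : ℂ) * (x : ℂ)))
        * Complex.exp (-(Complex.I * (n : ℂ) * (x : ℂ)))
      = ∑ i ∈ s, c i * Complex.exp (Complex.I * ((m i - n : ℤ) : ℂ) * (x : ℂ)) := by
    intro x
    rw [Finset.sum_mul]
    refine Finset.sum_congr rfl fun i _ => ?_
    rw [mul_assoc, ← Complex.exp_add]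
    congr 2
    push_cast; ring
  simp only [fc, e]
  rw [integral_finsetSum]
  · rw [Finset.mul_sum]
    refine Finset.sum_congr rfl fun i _ => ?_
    rw [integral_const_mul, integral_circ_exp]
    simp only [sub_eq_zero]
    split_ifs
    · have : (π : ℂ) ≠ 0 := by exact_mod_cast Real.pi_ne_zero
      push_cast; field_simp
    · simp
  · intro i _
    refine (integrableOn_circ_of_bounded (by fun_prop) 1 fun x => ?_).const_mul _
    exact (norm_exp_I_mul_int_mul _ x).le

lemma fcR_eq_zero_of_notMem {u : ℝ → ℝ} {s : Finset ℤ}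
    (hs : ∀ x : ℝ, (u x : ℂ) = ∑ k ∈ s, fcR u k * Complex.exp (Complex.I * (k : ℂ) * (x : ℂ)))
    {j : ℤ} (hj : j ∉ s) : fcR u j = 0 := by
  have h := fc_sum_exp s (fcR u) id j
  simp only [id, ← hs] at h
  change fcR u j = _ at h
  rw [h, Finset.sum_ite_eq' s j, if_neg hj]

/-- On trigonometric polynomials, `d_{1/2}u·d_{1/2}v` is a finite sum of exponentials. -/
lemma d12prod_eq_sum {u v : ℝ → ℝ} {s t : Finset ℤ} {a b : ℤ → ℂ}
    (hs : ∀ x : ℝ, (u x : ℂ) = ∑ k ∈ s, a k * Complex.exp (Complex.I * (k : ℂ) * (x : ℂ)))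
    (ht : ∀ x : ℝ, (v x : ℂ) = ∑ k ∈ t, b k * Complex.exp (Complex.I * (k : ℂ) * (x : ℂ)))
    (x : ℝ) :
    d12prod u v x = ∑ p ∈ s ×ˢ t, Cjk p.1 p.2 * a p.1 * b p.2
      * Complex.exp (Complex.I * ((p.1 + p.2 : ℤ) : ℂ) * (x : ℂ)) := by
  have e : ∀ y : ℝ, (((u x - u y) * (v x - v y) / cd x y ^ 2 : ℝ) : ℂ)
      = ∑ p ∈ s ×ˢ t, a p.1 * b p.2
        * Complex.exp (Complex.I * ((p.1 + p.2 : ℤ) : ℂ) * (x : ℂ)) * cKernel p.1 p.2 (y - x) := by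
    intro y
    have hcd : cd x y ^ 2 = 4 * Real.sin ((y - x) / 2) ^ 2 := by
      rw [cd, mul_pow, sq_abs, ← neg_sub y x, neg_div, Real.sin_neg, neg_sq]; norm_num
    have hexp : ∀ k : ℤ, Complex.exp (Complex.I * (k : ℂ) * (y : ℂ))
        = Complex.exp (Complex.I * (k : ℂ) * (x : ℂ))
          * Complex.exp (Complex.I * (k : ℂ) * ((y - x : ℝ) : ℂ)) := by
      intro k
      rw [← Complex.exp_add]; congr 1; push_cast; ring
    have hadd : ∀ j k : ℤ, Complex.exp (Complex.I * ((j + k : ℤ) : ℂ) * (x : ℂ))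
        = Complex.exp (Complex.I * (j : ℂ) * (x : ℂ))
          * Complex.exp (Complex.I * (k : ℂ) * (x : ℂ)) := by
      intro j k
      rw [← Complex.exp_add]; congr 1; push_cast; ring
    rw [hcd, Complex.ofReal_div, Complex.ofReal_mul, Complex.ofReal_sub, Complex.ofReal_sub,
      hs x, hs y, ht x, ht y, ← Finset.sum_sub_distrib, ← Finset.sum_sub_distrib,
      Finset.sum_mul_sum, ← Finset.sum_product', Finset.sum_div]
    refine Finset.sum_congr rfl fun p _ => ?_
    rw [hexp p.1, hexp p.2, hadd, cKernel]
    ring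
  rw [d12prod, ← integral_complex_ofReal]
  simp only [e]
  rw [integral_finsetSum]
  · refine Finset.sum_congr rfl fun p _ => ?_
    rw [integral_const_mul, integral_cKernel_sub]
    ring
  · intro p _
    refine (integrableOn_circ_of_bounded ?_ _ fun y => norm_cKernel_le p.1 p.2 (y - x)).const_mul _
    exact (measurable_cKernel p.1 p.2).comp (measurable_id.sub_const x)

/-- Fourier coefficients of `d_{1/2}u·d_{1/2}v` for trigonometric
polynomials: `ĝ(n) = Σ_j C(j,n-j) û(j) v̂(n-j)`. -/
theorem fourier_coeff_d12prod (u v : ℝ → ℝ) (hu : IsTrigPoly u) (hv : IsTrigPoly v) :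
    ∀ n : ℤ, fc (d12prod u v) n = ∑' j : ℤ, Cjk j (n - j) * fcR u j * fcR v (n - j) := by
  obtain ⟨s, hs⟩ := hu
  obtain ⟨t, ht⟩ := hv
  intro n
  rw [show d12prod u v = _ from funext (d12prod_eq_sum hs ht),
    fc_sum_exp (s ×ˢ t) (fun p => Cjk p.1 p.2 * fcR u p.1 * fcR v p.2) (fun p => p.1 + p.2) n,
    tsum_eq_sum (s := s) fun j hj => by rw [fcR_eq_zero_of_notMem hs hj, mul_zero, zero_mul],
    Finset.sum_product]
  refine Finset.sum_congr rfl fun j _ => ?_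
  simp only [← eq_sub_iff_add_eq']
  rw [Finset.sum_ite_eq' t (n - j)]
  split_ifs with h
  · rfl
  · rw [fcR_eq_zero_of_notMem ht h, mul_zero]
end
end
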